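/- Every smooth projective curve over an algebraically closed field of characteristic zero is birationally equivalent to a plane curve with only nodes as singularities. -/

import Mathlib

open MvPolynomial

variable {k : Type} [Field k]

/-- Iterated partial derivatives along a list of variable indices. -/
noncomputable def pderivList {n : ℕ} (s : List (Fin n)) (F : MvPolynomial (Fin n) k) :
    MvPolynomial (Fin n) k :=
  s.foldr (fun i G => pderiv i G) F

/-- The `m`-th directional derivative of `F` at `v` in direction `w`
(`m!` times the degree-`m` Taylor form). -/
noncomputable def dirDeriv {n : ℕ} (F : MvPolynomial (Fin n) k)
    (v w : Fin n → k) (m : ℕ) : k :=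
  ∑ s : Fin m → Fin n, eval v (pderivList (List.ofFn s) F) * ∏ j, w (s j)

/-- `F` has multiplicity (exactly) `m` at the point `v`: all partial derivatives of
order `< m` vanish at `v`, while some order-`m` derivative does not. -/
def HasMultiplicityAt {n : ℕ} (F : MvPolynomial (Fin n) k) (v : Fin n → k) (m : ℕ) : Prop :=
  (∀ s : List (Fin n), s.length < m → eval v (pderivList s F) = 0) ∧
    ∃ s : List (Fin n), s.length = m ∧ eval v (pderivList s F) ≠ 0

/-- A singular point of the projective plane curve `F = 0`. -/
def IsSingularAt (F : MvPolynomial (Fin 3) k) (v : Fin 3 → k) : Prop :=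
  v ≠ 0 ∧ eval v F = 0 ∧ ∀ i, eval v (pderiv i F) = 0

/-- A node (ordinary double point): multiplicity two with two distinct tangent
directions, i.e. the degree-2 tangent cone is not (a multiple of) a square of a linear form. -/
def IsNodeAt (F : MvPolynomial (Fin 3) k) (v : Fin 3 → k) : Prop :=
  v ≠ 0 ∧ eval v F = 0 ∧ HasMultiplicityAt F v 2 ∧
    ¬ ∃ (c : k) (l : Fin 3 → k), ∀ w : Fin 3 → k,
        dirDeriv F v w 2 = c * (∑ i, l i * w i) ^ 2

/-- An ordinary point of multiplicity `m`: the degree-`m` tangent cone factors into `m`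
pairwise distinct linear forms. -/
def IsOrdinaryAt (F : MvPolynomial (Fin 3) k) (v : Fin 3 → k) (m : ℕ) : Prop :=
  HasMultiplicityAt F v m ∧
    ∃ (c : k) (L : Fin m → (Fin 3 → k)), c ≠ 0 ∧
      (∀ i j, i ≠ j → ¬ ∃ t : k, L j = t • L i) ∧
      ∀ w : Fin 3 → k, dirDeriv F v w m = c * ∏ i, (∑ j, L i j * w j)

/-- An (irreducible) plane algebraic curve of degree `n` in `ℙ²`. -/
structure PlaneCurve (k : Type) [Field k] where
  n : ℕ
  F : MvPolynomial (Fin 3) k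
  homog : F.IsHomogeneous n
  irred : Irreducible F

/-- Birational equivalence of the projective curves `F = 0` and `G = 0`, expressed by a
pair of mutually inverse rational maps given by homogeneous polynomial triples. -/
def BirEquiv (F G : MvPolynomial (Fin 3) k) : Prop :=
  ∃ φ ψ : Fin 3 → MvPolynomial (Fin 3) k,
    (∃ d, ∀ i, (φ i).IsHomogeneous d) ∧
    (∃ e, ∀ i, (ψ i).IsHomogeneous e) ∧
    bind₁ φ G ∈ Ideal.span {F} ∧
    bind₁ ψ F ∈ Ideal.span {G} ∧
    (∃ lam : MvPolynomial (Fin 3) k, lam ∉ Ideal.span {F} ∧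
      ∀ i, bind₁ φ (ψ i) - lam * X i ∈ Ideal.span {F}) ∧
    (∃ mu : MvPolynomial (Fin 3) k, mu ∉ Ideal.span {G} ∧
      ∀ i, bind₁ ψ (φ i) - mu * X i ∈ Ideal.span {G})


/-- The (affine cone over the) zero locus in `ℙ^{N-1}` of an ideal of polynomials. -/
def projZeros {k : Type} [Field k] {N : ℕ} (I : Ideal (MvPolynomial (Fin N) k)) :
    Set (Fin N → k) :=
  {v | ∀ f ∈ I, eval v f = 0}

/-- The (cone over the) Zariski tangent space of `V(I)` at `v`. -/
noncomputable def tangentSpace {k : Type} [Field k] {N : ℕ}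
    (I : Ideal (MvPolynomial (Fin N) k)) (v : Fin N → k) : Submodule k (Fin N → k) :=
  ⨅ f ∈ I, LinearMap.ker (∑ i, eval v (pderiv i f) • (LinearMap.proj i : (Fin N → k) →ₗ[k] k))

/-- `I` defines an irreducible curve in `ℙ^{N-1}`: it is a homogeneous prime ideal whose
affine cone has Krull dimension 2. -/
structure IsProjCurveIdeal {k : Type} [Field k] {N : ℕ}
    (I : Ideal (MvPolynomial (Fin N) k)) : Prop where
  prime : I.IsPrime
  homog : ∃ S : Set (MvPolynomial (Fin N) k), I = Ideal.span S ∧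
    ∀ g ∈ S, ∃ d, g.IsHomogeneous d
  dim : ringKrullDim (MvPolynomial (Fin N) k ⧸ I) = 2

/-- `v` is a singular point of the curve `V(I)` (the tangent space is too big). -/
def IsSingularCurvePoint {k : Type} [Field k] {N : ℕ}
    (I : Ideal (MvPolynomial (Fin N) k)) (v : Fin N → k) : Prop :=
  v ≠ 0 ∧ v ∈ projZeros I ∧ Module.finrank k (tangentSpace I v) ≠ 2

/-- The curve `V(I)` is smooth. -/
def IsSmoothCurve {k : Type} [Field k] {N : ℕ}
    (I : Ideal (MvPolynomial (Fin N) k)) : Prop :=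
  ∀ v ∈ projZeros I, v ≠ 0 → Module.finrank k (tangentSpace I v) = 2

/-- The line `W` (a 2-dimensional subspace of `k⁴`) is a secant of `V(I)`:
it meets the curve in at least two distinct points of `ℙ³`. -/
def IsSecantOf {k : Type} [Field k] (I : Ideal (MvPolynomial (Fin 4) k))
    (W : Submodule k (Fin 4 → k)) : Prop :=
  Module.finrank k W = 2 ∧ ∃ v₁ v₂ : Fin 4 → k,
    v₁ ≠ 0 ∧ v₂ ≠ 0 ∧ v₁ ∈ W ∧ v₂ ∈ W ∧ v₁ ∈ projZeros I ∧ v₂ ∈ projZeros I ∧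
      ¬ ∃ c : k, v₂ = c • v₁

/-- The line `W` is a trisecant of `V(I)`: it meets the curve in at least three distinct
points of `ℙ³`. -/
def IsTrisecantOf {k : Type} [Field k] (I : Ideal (MvPolynomial (Fin 4) k))
    (W : Submodule k (Fin 4 → k)) : Prop :=
  Module.finrank k W = 2 ∧ ∃ v₁ v₂ v₃ : Fin 4 → k,
    v₁ ≠ 0 ∧ v₂ ≠ 0 ∧ v₃ ≠ 0 ∧ v₁ ∈ W ∧ v₂ ∈ W ∧ v₃ ∈ W ∧
    v₁ ∈ projZeros I ∧ v₂ ∈ projZeros I ∧ v₃ ∈ projZeros I ∧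
    (¬ ∃ c : k, v₂ = c • v₁) ∧ (¬ ∃ c : k, v₃ = c • v₁) ∧ (¬ ∃ c : k, v₃ = c • v₂)

/-- The line `W` is tangent to `V(I)` at some point. -/
def IsTangentLineOf {k : Type} [Field k] (I : Ideal (MvPolynomial (Fin 4) k))
    (W : Submodule k (Fin 4 → k)) : Prop :=
  Module.finrank k W = 2 ∧ ∃ v : Fin 4 → k,
    v ≠ 0 ∧ v ∈ projZeros I ∧ v ∈ W ∧ W ≤ tangentSpace I v

/-- Birational equivalence between the projective varieties `V(I) ⊆ ℙ^{N-1}` and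
`V(J) ⊆ ℙ^{M-1}`, given by mutually inverse rational maps with homogeneous polynomial
components. -/
def IdealBirEquiv {k : Type} [Field k] {N M : ℕ}
    (I : Ideal (MvPolynomial (Fin N) k)) (J : Ideal (MvPolynomial (Fin M) k)) : Prop :=
  ∃ (φ : Fin M → MvPolynomial (Fin N) k) (ψ : Fin N → MvPolynomial (Fin M) k),
    (∃ d, ∀ i, (φ i).IsHomogeneous d) ∧ (∃ e, ∀ i, (ψ i).IsHomogeneous e) ∧
    (∀ g ∈ J, bind₁ φ g ∈ I) ∧ (∀ f ∈ I, bind₁ ψ f ∈ J) ∧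
    (∃ lam, lam ∉ I ∧ ∀ i, bind₁ φ (ψ i) - lam * X i ∈ I) ∧
    (∃ mu, mu ∉ J ∧ ∀ i, bind₁ ψ (φ i) - mu * X i ∈ J)

open MvPolynomial

theorem exists_section_of_smooth {P K E : Type*} [CommRing P] [Field K] [CommRing E] [Algebra P K]
    [Algebra P E] [Algebra.FormallySmooth P K] (f : E →ₐ[P] K) (hf : Function.Surjective f)
    (hn : IsNilpotent (RingHom.ker f)) : ∃ g : K →ₐ[P] E, ∀ x, f (g x) = x :=
  ⟨Algebra.FormallySmooth.liftOfSurjective (AlgHom.id P K) f hf hn, fun x =>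
    Algebra.FormallySmooth.liftOfSurjective_apply (AlgHom.id P K) f hf hn x⟩

theorem formallySmooth_of_basis {k K ι : Type} [Field k] [CharZero k] [Field K] [Algebra k K]
    [Algebra (MvPolynomial ι k) K] (x : ι → K) (hx : IsTranscendenceBasis k x)
    (hal : ∀ p : MvPolynomial ι k, algebraMap _ K p = aeval x p) :
    Algebra.FormallySmooth (MvPolynomial ι k) K := by
  have inj : Function.Injective (algebraMap (MvPolynomial ι k) K) := by
    intro p q h
    rw [hal, hal] at h
    exact hx.1 h
  haveI : FaithfulSMul (MvPolynomial ι k) K := (faithfulSMul_iff_algebraMap_injective _ _).2 inj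
  letI := FractionRing.liftAlgebra (MvPolynomial ι k) K
  have h1 : Algebra.IsAlgebraic (MvPolynomial ι k) K := by
    constructor
    intro y
    have := hx.isAlgebraic.isAlgebraic y
    refine this.of_ringHom_of_comp_eq (f := hx.1.aevalEquiv.toRingEquiv.toRingHom) (RingHom.id K)
      ?_ ?_ ?_
    · exact hx.1.aevalEquiv.surjective
    · exact fun _ _ h => h
    · ext p
      · simp [hal]
      · simp [hal]
  have h2 : Algebra.IsAlgebraic (FractionRing (MvPolynomial ι k)) K :=
    (IsFractionRing.comap_isAlgebraic_iff (A := MvPolynomial ι k)).1 h1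
  haveI : CharZero (FractionRing (MvPolynomial ι k)) :=
    charZero_of_injective_algebraMap (IsFractionRing.injective (MvPolynomial ι k) _)
  haveI : Algebra.FormallyEtale (FractionRing (MvPolynomial ι k)) K :=
    Algebra.FormallyEtale.of_isSeparable _ _
  haveI : Algebra.FormallyEtale (MvPolynomial ι k) (FractionRing (MvPolynomial ι k)) :=
    Algebra.FormallyEtale.of_isLocalization (nonZeroDivisors _)
  exact Algebra.FormallySmooth.comp _ (FractionRing (MvPolynomial ι k)) _

theorem exists_derivation_of_basis {k K ι : Type} [Field k] [CharZero k] [Field K] [Algebra k K]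
    (x : ι → K) (hx : IsTranscendenceBasis k x) (y : ι → K) :
    ∃ D : Derivation k K K, ∀ i, D (x i) = y i := by
  letI a1 : Algebra (MvPolynomial ι k) K := (aeval x).toRingHom.toAlgebra
  haveI := formallySmooth_of_basis x hx (fun p => rfl)
  let e : MvPolynomial ι k →ₐ[k] TrivSqZeroExt K K :=
    aeval (fun i => TrivSqZeroExt.inl (x i) + TrivSqZeroExt.inr (y i))
  letI a2 : Algebra (MvPolynomial ι k) (TrivSqZeroExt K K) := e.toRingHom.toAlgebra
  have he : ∀ p, algebraMap (MvPolynomial ι k) (TrivSqZeroExt K K) p = e p := fun p => rfl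
  have hfe : (TrivSqZeroExt.fstHom k K K).comp e = aeval x := by
    ext i; simp [e]
  let f : TrivSqZeroExt K K →ₐ[MvPolynomial ι k] K :=
    { (TrivSqZeroExt.fstHom k K K).toRingHom with
      commutes' := fun p => by
        have := DFunLike.congr_fun hfe p
        exact this }
  have hfv : ∀ z, f z = z.fst := fun z => rfl
  obtain ⟨g, hg⟩ := exists_section_of_smooth f (fun z => ⟨TrivSqZeroExt.inl z, rfl⟩) (by
    refine ⟨2, ?_⟩
    rw [pow_two, Ideal.zero_eq_bot, eq_bot_iff, Ideal.mul_le]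
    intro r hr s hs
    have hr' : r.fst = 0 := hr
    have hs' : s.fst = 0 := hs
    rw [Ideal.mem_bot]
    ext <;> simp [hr', hs'])
  have hg' : ∀ z, (g z).fst = z := hg
  have hgk : ∀ c : k, g (algebraMap k K c) = TrivSqZeroExt.inl (algebraMap k K c) := by
    intro c
    have h1 := g.commutes (C c)
    have h2 : algebraMap (MvPolynomial ι k) K (C c) = algebraMap k K c := by
      change aeval x (C c) = _
      simp
    rw [h2, he] at h1
    rw [h1]
    simp [e]
    rfl
  refine ⟨Derivation.mk' (LinearMap.mk ⟨fun z => (g z).snd, ?_⟩ ?_) ?_, ?_⟩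
  · intro u v; simp
  · intro c u
    simp only [Algebra.smul_def, map_mul, hgk, RingHom.id_apply]
    simp
  · intro u v
    simp [hg', mul_comm]
  · intro i
    have h1 := g.commutes (X i)
    have h2 : algebraMap (MvPolynomial ι k) K (X i) = x i := by
      change aeval x (X i) = _
      simp
    rw [h2, he] at h1
    change (g (x i)).snd = _
    rw [h1]
    simp [e]

theorem exists_derivation_of_algInd {k K σ : Type} [Field k] [CharZero k] [Field K] [Algebra k K]
    (x : σ → K) (hx : AlgebraicIndependent k x) (y : σ → K) :
    ∃ D : Derivation k K K, ∀ i, D (x i) = y i := by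
  obtain ⟨t, ht, hb⟩ := exists_isTranscendenceBasis_superset (R := k) (s := Set.range x)
    (hx.coe_range)
  obtain ⟨D, hD⟩ := exists_derivation_of_basis _ hb
    (fun i => Function.extend x y 0 (i : K))
  refine ⟨D, fun i => ?_⟩
  have := hD ⟨x i, ht ⟨i, rfl⟩⟩
  rw [this]
  exact hx.injective.extend_apply _ _ _

open MvPolynomial

theorem exists_generic (k : Type) [Field k] [Infinite k] (σ : Type) :
    ∃ (U : Ultrafilter (σ → k)) (K : Type) (_ : Field K) (_ : Algebra k K)
      (π : ((σ → k) → k) →ₐ[k] K), Function.Surjective π ∧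
      (∀ f g, π f = π g ↔ ∀ᶠ a in U, f a = g a) ∧
      AlgebraicIndependent k (fun i : σ => π (fun a => a i)) := by
  let F : Filter (σ → k) :=
    { sets := {S | ∃ g : MvPolynomial σ k, g ≠ 0 ∧ ∀ a, eval a g ≠ 0 → a ∈ S}
      univ_sets := ⟨1, one_ne_zero, fun _ _ => trivial⟩
      sets_of_superset := fun ⟨g, hg, h⟩ hST => ⟨g, hg, fun a ha => hST (h a ha)⟩
      inter_sets := fun ⟨g, hg, h⟩ ⟨g', hg', h'⟩ => ⟨g * g', mul_ne_zero hg hg', fun a ha => by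
        rw [map_mul] at ha
        exact ⟨h a (left_ne_zero_of_mul ha), h' a (right_ne_zero_of_mul ha)⟩⟩ }
  haveI : F.NeBot := by
    refine ⟨fun h => ?_⟩
    have : (∅ : Set (σ → k)) ∈ F := by rw [h]; trivial
    obtain ⟨g, hg, h⟩ := this
    refine hg (MvPolynomial.funext fun x => ?_)
    by_contra hx
    exact h x (by simpa using hx)
  let U := Ultrafilter.of F
  have hU : ∀ g : MvPolynomial σ k, g ≠ 0 → ∀ᶠ a in U, eval a g ≠ 0 := fun g hg =>
    Ultrafilter.of_le F ⟨g, hg, fun a ha => ha⟩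
  let cr : ((σ → k) → k) →+* Filter.Germ (U : Filter (σ → k)) k := Filter.Germ.coeRingHom _
  letI alg : Algebra k (Filter.Germ (U : Filter (σ → k)) k) :=
    (cr.comp (Pi.constRingHom (σ → k) k)).toAlgebra
  let π : ((σ → k) → k) →ₐ[k] Filter.Germ (U : Filter (σ → k)) k :=
    { cr with commutes' := fun c => rfl }
  have hπ : ∀ f g, π f = π g ↔ ∀ᶠ a in U, f a = g a := fun f g => Filter.Germ.coe_eq
  refine ⟨U, Filter.Germ (U : Filter (σ → k)) k, inferInstance, alg, π, ?_, hπ, ?_⟩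
  · intro x
    induction x using Filter.Germ.inductionOn with
    | _ f => exact ⟨f, rfl⟩
  · rw [algebraicIndependent_iff]
    intro p hp
    by_contra hne
    have h1 : aeval (fun i : σ => π (fun a => a i)) p = π (fun a => eval a p) := by
      clear hne hp
      induction p using MvPolynomial.induction_on with
      | C c =>
        simp only [aeval_C, eval_C]
        exact (π.commutes c).symm
      | add p q hp hq =>
        simp only [map_add, hp, hq]
        rw [← map_add]; rfl
      | mul_X p i hp =>
        simp only [map_mul, hp, aeval_X, eval_X]
        rw [← map_mul]; rfl
    rw [h1, ← map_zero π, hπ] at hp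
    obtain ⟨a, ha1, ha2⟩ := (hp.and (hU p hne)).exists
    exact ha2 (by simpa using ha1)

section Hat

variable {k : Type} [Field k] {n : ℕ} {Ω K : Type} [Field K] [Algebra k K]

/-- The vector of germs of a vector-valued function. -/
def hat {ι : Type} (π : (Ω → k) →ₐ[k] K) (P : Ω → ι → k) : ι → K := fun i => π (fun ω => P ω i)

theorem hat_surj {ι : Type} (π : (Ω → k) →ₐ[k] K) (hs : Function.Surjective π) (x : ι → K) :
    ∃ P : Ω → ι → k, hat π P = x := by
  choose f hf using hs
  exact ⟨fun ω i => f (x i) ω, funext fun i => hf (x i)⟩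

theorem hat_eq {ι : Type} [Finite ι] (π : (Ω → k) →ₐ[k] K) (U : Ultrafilter Ω)
    (hπ : ∀ f g, π f = π g ↔ ∀ᶠ a in U, f a = g a) (P Q : Ω → ι → k) :
    hat π P = hat π Q ↔ ∀ᶠ ω in U, P ω = Q ω := by
  constructor
  · intro h
    have : ∀ i, ∀ᶠ ω in U, P ω i = Q ω i := fun i => (hπ _ _).1 (congr_fun h i)
    filter_upwards [Filter.eventually_all.2 this] with ω hω
    exact funext hω
  · intro h
    funext i
    refine (hπ _ _).2 ?_
    filter_upwards [h] with ω hω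
    rw [hω]

theorem hat_ne_zero {ι : Type} [Finite ι] (π : (Ω → k) →ₐ[k] K) (U : Ultrafilter Ω)
    (hπ : ∀ f g, π f = π g ↔ ∀ᶠ a in U, f a = g a) (P : Ω → ι → k)
    (h : ∀ᶠ ω in U, P ω ≠ 0) : hat π P ≠ 0 := by
  intro h0
  have : hat π (fun _ => 0 : Ω → ι → k) = 0 := by
    funext i
    exact map_zero π
  rw [← this, hat_eq π U hπ] at h0
  obtain ⟨ω, h1, h2⟩ := (h.and h0).exists
  exact h1 h2

theorem aeval_hat {ι : Type} (π : (Ω → k) →ₐ[k] K) (P : Ω → ι → k) (f : MvPolynomial ι k) :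
    aeval (hat π P) f = π (fun ω => eval (P ω) f) := by
  induction f using MvPolynomial.induction_on with
  | C c =>
    simp only [aeval_C, eval_C]
    exact (π.commutes c).symm
  | add p q hp hq =>
    simp only [map_add, hp, hq]
    rw [← map_add]; rfl
  | mul_X p i hp =>
    simp only [map_mul, hp, aeval_X, eval_X]
    rw [hat, ← map_mul]; rfl

theorem mem_tangentSpace (I : Ideal (MvPolynomial (Fin n) k)) (v x : Fin n → k) :
    x ∈ tangentSpace I v ↔ ∀ f ∈ I, ∑ i, eval v (pderiv i f) * x i = 0 := by
  simp [tangentSpace, Submodule.mem_iInf, LinearMap.mem_ker, LinearMap.sum_apply]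

theorem mem_tangentSpace_of_span (S : Set (MvPolynomial (Fin n) k)) (v x : Fin n → k)
    (hv : v ∈ projZeros (Ideal.span S))
    (h : ∀ f ∈ S, ∑ i, eval v (pderiv i f) * x i = 0) :
    x ∈ tangentSpace (Ideal.span S) v := by
  rw [mem_tangentSpace]
  intro f hf
  induction hf using Submodule.span_induction with
  | mem f hf => exact h f hf
  | zero => simp
  | add f g _ _ hf hg =>
    simp only [map_add, add_mul, Finset.sum_add_distrib, hf, hg, add_zero]
  | smul a f hfm hf =>
    have h0 : eval v f = 0 := hv f hfm
    have : ∀ i, eval v (pderiv i (a • f)) * x i = eval v a * (eval v (pderiv i f) * x i) := by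
      intro i
      simp [smul_eq_mul, Derivation.leibniz, h0]
      ring
    simp only [this, ← Finset.mul_sum, hf, mul_zero]

theorem hat_tangent (π : (Ω → k) →ₐ[k] K) (hs : Function.Surjective π) (U : Ultrafilter Ω)
    (hπ : ∀ f g, π f = π g ↔ ∀ᶠ a in U, f a = g a)
    (S : Set (MvPolynomial (Fin n) k)) (P τ : Ω → Fin n → k)
    (hP : ∀ᶠ ω in U, P ω ∈ projZeros (Ideal.span S))
    (hT : ∀ᶠ ω in U, ∀ x ∈ tangentSpace (Ideal.span S) (P ω), ∃ c d : k, x = c • P ω + d • τ ω)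
    (x : Fin n → K) (hx : ∀ f ∈ S, ∑ i, aeval (hat π P) (pderiv i f) * x i = 0) :
    ∃ c d : K, x = c • hat π P + d • hat π τ := by
  obtain ⟨ξ, rfl⟩ := hat_surj π hs x
  obtain ⟨S', hS', hspan⟩ :=
    Submodule.fg_span_iff_fg_span_finset_subset S |>.1 (IsNoetherian.noetherian (Ideal.span S))
  have h1 : ∀ f ∈ S', ∀ᶠ ω in U, ∑ i, eval (P ω) (pderiv i f) * ξ ω i = 0 := by
    intro f hf
    have := hx f (hS' hf)
    simp only [aeval_hat, hat, ← map_mul, ← map_sum] at this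
    rw [← map_zero π, hπ] at this
    filter_upwards [this] with ω hω
    simpa using hω
  have h2 : ∀ᶠ ω in U, ∀ f ∈ S', ∑ i, eval (P ω) (pderiv i f) * ξ ω i = 0 :=
    (Filter.eventually_all_finset S').2 h1
  have h3 : ∀ᶠ ω in U, ∃ cd : k × k, ξ ω = cd.1 • P ω + cd.2 • τ ω := by
    filter_upwards [hP, hT, h2] with ω a b c
    have hI : Ideal.span S = Ideal.span (S' : Set (MvPolynomial (Fin n) k)) := hspan
    rw [hI] at a b
    obtain ⟨c, d, h⟩ := b _ (mem_tangentSpace_of_span _ _ _ a c)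
    exact ⟨(c, d), h⟩
  obtain ⟨cd, hcd⟩ := h3.choice
  refine ⟨π (fun ω => (cd ω).1), π (fun ω => (cd ω).2), ?_⟩
  have : hat π ξ = hat π (fun ω => (cd ω).1 • P ω + (cd ω).2 • τ ω) := (hat_eq π U hπ _ _).2 hcd
  rw [this]
  funext i
  simp only [hat, Pi.add_apply, Pi.smul_apply, smul_eq_mul, ← map_mul, ← map_add]
  rfl

theorem deriv_aeval (D : Derivation k K K) (p : Fin n → K) (f : MvPolynomial (Fin n) k) :
    D (aeval p f) = ∑ i, aeval p (pderiv i f) * D (p i) := by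
  induction f using MvPolynomial.induction_on with
  | C c => simp
  | add p q hp hq => simp [hp, hq, add_mul, Finset.sum_add_distrib]
  | mul_X q j hq =>
    simp only [map_mul, aeval_X, Derivation.leibniz, hq, smul_eq_mul, map_add, add_mul,
      Finset.sum_add_distrib, pderiv_X, Finset.mul_sum]
    congr 1
    · rw [Finset.sum_eq_single j]
      · simp
      · intro b _ hb
        simp [Pi.single_apply, Ne.symm hb]
      · simp
    · refine Finset.sum_congr rfl fun i _ => by ring

theorem hat_deriv (π : (Ω → k) →ₐ[k] K) (hs : Function.Surjective π) (U : Ultrafilter Ω)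
    (hπ : ∀ f g, π f = π g ↔ ∀ᶠ a in U, f a = g a)
    (I : Ideal (MvPolynomial (Fin n) k)) (P τ : Ω → Fin n → k)
    (hP : ∀ᶠ ω in U, P ω ∈ projZeros I)
    (hT : ∀ᶠ ω in U, ∀ x ∈ tangentSpace I (P ω), ∃ c d : k, x = c • P ω + d • τ ω)
    (D : Derivation k K K) :
    ∃ c d : K, (fun i => D (hat π P i)) = c • hat π P + d • hat π τ := by
  refine hat_tangent π hs U hπ (I : Set (MvPolynomial (Fin n) k)) P τ
    (by simpa only [Ideal.span_eq] using hP) (by simpa only [Ideal.span_eq] using hT) _ ?_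
  intro f hf
  rw [← deriv_aeval, aeval_hat]
  have : π (fun ω => eval (P ω) f) = π 0 := by
    rw [hπ]
    filter_upwards [hP] with ω hω
    exact hω f hf
  rw [this]; simp

theorem hat_deriv2 (π : (Ω → k) →ₐ[k] K) (hs : Function.Surjective π) (U : Ultrafilter Ω)
    (hπ : ∀ f g, π f = π g ↔ ∀ᶠ a in U, f a = g a)
    (S : Set (MvPolynomial (Fin n) k)) (hS : ∀ g ∈ S, ∃ d, g.IsHomogeneous d)
    (P τ : Ω → Fin n → k)
    (hP : ∀ᶠ ω in U, P ω ∈ projZeros (Ideal.span S))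
    (hτ : ∀ᶠ ω in U, τ ω ∈ tangentSpace (Ideal.span S) (P ω))
    (hT : ∀ᶠ ω in U, ∀ x ∈ tangentSpace (Ideal.span S) (P ω), ∃ c d : k, x = c • P ω + d • τ ω)
    (D : Derivation k K K) (c : K) (hD : (fun i => D (hat π P i)) = c • hat π P) :
    ∃ c d : K, (fun i => D (hat π τ i)) = c • hat π P + d • hat π τ := by
  refine hat_tangent π hs U hπ S P τ hP hT _ ?_
  intro f hf
  obtain ⟨d, hd⟩ := hS f hf
  have h1 : ∑ i, aeval (hat π P) (pderiv i f) * hat π τ i = 0 := by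
    simp only [aeval_hat, hat, ← map_mul, ← map_sum]
    rw [← map_zero π, hπ]
    filter_upwards [hτ] with ω hω
    rw [mem_tangentSpace] at hω
    simpa using hω f (Ideal.subset_span hf)
  have h2 : ∀ i, D (aeval (hat π P) (pderiv i f))
      = c * ((d - 1 : ℕ) * aeval (hat π P) (pderiv i f)) := by
    intro i
    rw [deriv_aeval]
    have hd' : ∀ j, D (hat π P j) = c * hat π P j := fun j => congr_fun hD j
    have he := congr_arg (aeval (hat π P)) ((hd.pderiv (i := i)).sum_X_mul_pderiv)
    simp only [map_sum, map_mul, aeval_X, map_nsmul, nsmul_eq_mul, map_natCast] at he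
    rw [← he, Finset.mul_sum]
    refine Finset.sum_congr rfl fun j _ => ?_
    rw [hd']; ring
  have h3 := congr_arg D h1
  simp only [map_sum, Derivation.leibniz, smul_eq_mul, map_zero, h2, Finset.sum_add_distrib] at h3
  have h4 : ∑ i, hat π τ i * (c * ((d - 1 : ℕ) * aeval (hat π P) (pderiv i f)))
      = c * (d - 1 : ℕ) * ∑ i, aeval (hat π P) (pderiv i f) * hat π τ i := by
    rw [Finset.mul_sum]
    exact Finset.sum_congr rfl fun j _ => by ring
  rw [h4, h1, mul_zero, add_zero] at h3
  exact h3

end Hat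

open MvPolynomial

section LinAlg

variable {K : Type} [Field K] {n : ℕ}

/-- The linear map `K^n → K^3` with coefficient matrix `a`. -/
def linL (a : Fin 3 × Fin n → K) : (Fin n → K) →ₗ[K] (Fin 3 → K) where
  toFun x := fun i => ∑ j, a (i, j) * x j
  map_add' x y := by
    funext i; simp [mul_add, Finset.sum_add_distrib]
  map_smul' c x := by
    funext i
    simp only [Pi.smul_apply, smul_eq_mul, RingHom.id_apply, Finset.mul_sum]
    exact Finset.sum_congr rfl fun j _ => by ring

theorem linL_apply (a : Fin 3 × Fin n → K) (x : Fin n → K) (i : Fin 3) :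
    linL a x i = ∑ j, a (i, j) * x j := rfl

theorem finrank_le_of_span {V : Type} [AddCommGroup V] [Module K V] {m : ℕ} (x : Fin m → V)
    (h : ∀ b : V, ∃ c : Fin m → K, b = ∑ i, c i • x i) : Module.finrank K V ≤ m := by
  have : Function.Surjective (Fintype.linearCombination K x) := by
    intro b
    obtain ⟨c, hc⟩ := h b
    exact ⟨c, by rw [hc]; rfl⟩
  have := LinearMap.finrank_le_finrank_of_surjective this
  simpa using this

theorem exists_linear_of_li {V W : Type} [AddCommGroup V] [Module K V] [AddCommGroup W]
    [Module K W] {m : ℕ} (u : Fin m → V) (hu : LinearIndependent K u) (b : Fin m → W) :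
    ∃ T : V →ₗ[K] W, ∀ i, T (u i) = b i := by
  have hinj : LinearMap.ker (Fintype.linearCombination K u) = ⊥ := by
    rw [LinearMap.ker_eq_bot]
    exact (linearIndependent_iff_injective_fintypeLinearCombination).1 hu
  obtain ⟨g, hg⟩ := LinearMap.exists_leftInverse_of_injective _ hinj
  refine ⟨(Fintype.linearCombination K b).comp g, fun i => ?_⟩
  have h1 : g (u i) = Pi.single i 1 := by
    have := LinearMap.congr_fun hg (Pi.single i 1)
    simpa [Fintype.linearCombination_apply_single] using this
  simp [h1, Fintype.linearCombination_apply_single]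

theorem exists_linL (T : (Fin n → K) →ₗ[K] (Fin 3 → K)) : ∃ y : Fin 3 × Fin n → K, linL y = T := by
  refine ⟨fun ij => T (Pi.single ij.2 1) ij.1, ?_⟩
  refine LinearMap.pi_ext' fun j => LinearMap.ext_ring ?_
  funext i
  simp [linL_apply, Pi.single_apply]

variable {k : Type} [Field k] [Algebra k K]

theorem deriv_linL (D : Derivation k K K) (a : Fin 3 × Fin n → K) (p : Fin n → K) :
    (fun i => D (linL a p i)) = linL (fun s => D (a s)) p + linL a (fun j => D (p j)) := by
  funext i
  simp only [linL_apply, Pi.add_apply, map_sum, Derivation.leibniz, smul_eq_mul,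
    Finset.sum_add_distrib]
  rw [add_comm]
  congr 1
  exact Finset.sum_congr rfl fun j _ => by ring

theorem arbm (a : Fin 3 × Fin n → K)
    (arb : ∀ y : Fin 3 × Fin n → K, ∃ D : Derivation k K K, ∀ s, D (a s) = y s)
    {m : ℕ} (u : Fin m → Fin n → K) (hu : LinearIndependent K u) (b : Fin m → Fin 3 → K) :
    ∃ D : Derivation k K K, ∀ i, linL (fun s => D (a s)) (u i) = b i := by
  obtain ⟨T, hT⟩ := exists_linear_of_li u hu b
  obtain ⟨y, hy⟩ := exists_linL T
  obtain ⟨D, hD⟩ := arb y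
  refine ⟨D, fun i => ?_⟩
  rw [funext hD, hy, hT]

theorem arb1 (a : Fin 3 × Fin n → K)
    (arb : ∀ y : Fin 3 × Fin n → K, ∃ D : Derivation k K K, ∀ s, D (a s) = y s)
    (u : Fin n → K) (hu : u ≠ 0) (b : Fin 3 → K) :
    ∃ D : Derivation k K K, linL (fun s => D (a s)) u = b := by
  obtain ⟨D, hD⟩ := arbm a arb ![u] (by simpa using hu) ![b]
  exact ⟨D, by simpa using hD 0⟩

theorem core1 (a : Fin 3 × Fin n → K)
    (arb : ∀ y : Fin 3 × Fin n → K, ∃ D : Derivation k K K, ∀ s, D (a s) = y s)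
    (p τ : Fin n → K) (hp : p ≠ 0) (hL : linL a p = 0)
    (h : ∀ D : Derivation k K K, ∃ c d : K, (fun i => D (p i)) = c • p + d • τ) : False := by
  have := finrank_le_of_span (K := K) (V := Fin 3 → K) ![linL a τ] (by
    intro b
    obtain ⟨D, hD⟩ := arb1 a arb p hp b
    obtain ⟨c, d, hcd⟩ := h D
    have h1 := deriv_linL D a p
    rw [hD, hcd, map_add, map_smul, map_smul, hL] at h1
    refine ⟨![-d], ?_⟩
    have h2 : (fun i => D ((0 : Fin 3 → K) i)) = 0 := by funext i; simp
    rw [h2] at h1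
    simp
    linear_combination (norm := module) -h1)
  simp at this

theorem core2 (a : Fin 3 × Fin n → K)
    (arb : ∀ y : Fin 3 × Fin n → K, ∃ D : Derivation k K K, ∀ s, D (a s) = y s)
    (p τ : Fin n → K) (hp : τ ≠ 0) (hL : linL a τ = 0)
    (h : ∀ D : Derivation k K K, ∃ c d : K, (fun i => D (p i)) = c • p + d • τ)
    (h' : ∀ (D : Derivation k K K) (c : K), (fun i => D (p i)) = c • p →
      ∃ c d : K, (fun i => D (τ i)) = c • p + d • τ) : False := by
  have key : ∀ (D : Derivation k K K) (c : K), (fun i => D (p i)) = c • p →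
      ∃ e : K, linL (fun s => D (a s)) τ = e • linL a p := by
    intro D c hD
    obtain ⟨c', d', h2⟩ := h' D c hD
    have h1 := deriv_linL D a τ
    rw [h2, map_add, map_smul, map_smul, hL] at h1
    have h2 : (fun i => D ((0 : Fin 3 → K) i)) = 0 := by funext i; simp
    rw [h2] at h1
    refine ⟨-c', ?_⟩
    rw [neg_smul]
    linear_combination (norm := module) -h1
  by_cases hA : ∀ D : Derivation k K K, ∃ c : K, (fun i => D (p i)) = c • p
  · have := finrank_le_of_span (K := K) (V := Fin 3 → K) ![linL a p] (by
      intro b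
      obtain ⟨D, hD⟩ := arb1 a arb τ hp b
      obtain ⟨c, hc⟩ := hA D
      obtain ⟨e, he⟩ := key D c hc
      exact ⟨![e], by rw [← hD, he]; simp⟩)
    simp at this
  · push Not at hA
    obtain ⟨D0, hD0⟩ := hA
    obtain ⟨c0, d0, h0⟩ := h D0
    have hd0 : d0 ≠ 0 := by
      rintro rfl
      exact hD0 c0 (by simpa using h0)
    have := finrank_le_of_span (K := K) (V := Fin 3 → K)
        ![linL a p, linL (fun s => D0 (a s)) τ] (by
      intro b
      obtain ⟨D, hD⟩ := arb1 a arb τ hp b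
      obtain ⟨c, d, hcd⟩ := h D
      obtain ⟨e, he⟩ := key (D - (d / d0) • D0) (c - d / d0 * c0) (by
        funext i
        have e1 := congr_fun hcd i
        have e2 := congr_fun h0 i
        simp only [Pi.add_apply, Pi.smul_apply, smul_eq_mul] at e1 e2
        simp only [Derivation.sub_apply, Derivation.smul_apply, smul_eq_mul, e1, e2, Pi.smul_apply]
        field_simp
        ring)
      refine ⟨![e, d / d0], ?_⟩
      have h3 : linL (fun s => (D - (d / d0) • D0) (a s)) τ
          = b - (d / d0) • linL (fun s => D0 (a s)) τ := by
        rw [← hD]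
        funext i
        simp only [linL_apply, Pi.sub_apply, Pi.smul_apply, smul_eq_mul, Finset.mul_sum,
          ← Finset.sum_sub_distrib, Derivation.sub_apply, Derivation.smul_apply]
        exact Finset.sum_congr rfl fun j _ => by ring
      rw [h3] at he
      simp
      linear_combination (norm := module) he)
    simp at this

theorem diff_formula (a : Fin 3 × Fin n → K) (D : Derivation k K K)
    (p q : Fin n → K) (h : linL a p = linL a q) :
    linL (fun s => D (a s)) (p - q) = linL a (fun j => D (q j)) - linL a (fun j => D (p j)) := by
  have h1 := deriv_linL D a p
  have h2 := deriv_linL D a q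
  rw [h, h2] at h1
  rw [map_sub]
  linear_combination (norm := module) -h1

theorem core4 (a : Fin 3 × Fin n → K)
    (arb : ∀ y : Fin 3 × Fin n → K, ∃ D : Derivation k K K, ∀ s, D (a s) = y s)
    (p q τ ρ : Fin n → K) (hp : p ≠ q) (hL : linL a p = linL a q)
    (h : ∀ D : Derivation k K K, ∃ c d : K, (fun i => D (p i)) = c • p + d • τ)
    (h' : ∀ D : Derivation k K K, ∃ c d : K, (fun i => D (q i)) = c • q + d • ρ)
    (l : (Fin 3 → K) →ₗ[K] K) (hl : l ≠ 0) (hlp : l (linL a p) = 0)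
    (hlτ : l (linL a τ) = 0) (hlρ : l (linL a ρ) = 0) : False := by
  refine hl (LinearMap.ext fun b => ?_)
  obtain ⟨D, hD⟩ := arb1 a arb (p - q) (sub_ne_zero.2 hp) b
  obtain ⟨c, d, h1⟩ := h D
  obtain ⟨c', d', h2⟩ := h' D
  rw [diff_formula a D p q hL, h1, h2] at hD
  rw [← hD]
  simp [hlp, hlτ, hlρ, ← hL]

theorem core5 (a : Fin 3 × Fin n → K)
    (arb : ∀ y : Fin 3 × Fin n → K, ∃ D : Derivation k K K, ∀ s, D (a s) = y s)
    (p q ρ : Fin n → K) (hp : p ≠ q) (hL : linL a p = linL a q)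
    (h : ∀ D : Derivation k K K, (fun i => D (p i)) = 0)
    (h' : ∀ D : Derivation k K K, ∃ c d : K, (fun i => D (q i)) = c • q + d • ρ) : False := by
  have := finrank_le_of_span (K := K) (V := Fin 3 → K) ![linL a q, linL a ρ] (by
    intro b
    obtain ⟨D, hD⟩ := arb1 a arb (p - q) (sub_ne_zero.2 hp) b
    obtain ⟨c', d', h2⟩ := h' D
    rw [diff_formula a D p q hL, h D, h2] at hD
    rw [← hD]
    exact ⟨![c', d'], by simp⟩)
  simp at this

theorem core3 (a : Fin 3 × Fin n → K)
    (arb : ∀ y : Fin 3 × Fin n → K, ∃ D : Derivation k K K, ∀ s, D (a s) = y s)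
    (p q r τ ρ θ : Fin n → K) (hpq : p ≠ q) (hpr : p ≠ r) (hqr : q ≠ r)
    (hL : linL a p = linL a q) (hL' : linL a p = linL a r)
    (hp : ∀ D : Derivation k K K, ∃ c d : K, (fun i => D (p i)) = c • p + d • τ)
    (hq : ∀ D : Derivation k K K, ∃ c d : K, (fun i => D (q i)) = c • q + d • ρ)
    (hr : ∀ D : Derivation k K K, ∃ c d : K, (fun i => D (r i)) = c • r + d • θ) : False := by
  by_cases hli : LinearIndependent K ![p - q, p - r]
  · have := finrank_le_of_span (K := K) (V := (Fin 3 → K) × (Fin 3 → K))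
      ![(linL a p, 0), (0, linL a p), (linL a τ, linL a τ), (linL a ρ, 0), (0, linL a θ)] (by
      rintro ⟨b, b'⟩
      obtain ⟨D, hD⟩ := arbm a arb _ hli ![b, b']
      have hD1 := hD 0
      have hD2 := hD 1
      simp only [Matrix.cons_val_zero, Matrix.cons_val_one] at hD1 hD2
      obtain ⟨c, d, h1⟩ := hp D
      obtain ⟨c', d', h2⟩ := hq D
      obtain ⟨c'', d'', h3⟩ := hr D
      rw [diff_formula a D p q hL, h1, h2] at hD1
      rw [diff_formula a D p r hL', h1, h3] at hD2
      refine ⟨![c' - c, c'' - c, -d, d', d''], ?_⟩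
      rw [← hD1, ← hD2]
      simp only [Fin.sum_univ_five, Matrix.cons_val, Prod.smul_mk, Prod.mk_add_mk,
        map_add, map_smul, ← hL, ← hL']
      refine Prod.ext ?_ ?_ <;> simp only [] <;> module)
    simp at this
  · have hdep : ∃ β : K, p - r = β • (p - q) := by
      by_contra hno
      refine hli ((LinearIndependent.pair_iff' (sub_ne_zero.2 hpq)).2 fun β hβ => hno ⟨β, hβ.symm⟩)
    obtain ⟨β, hβ⟩ := hdep
    have hβ0 : β ≠ 0 := by
      rintro rfl
      exact hpr (sub_eq_zero.1 (by simpa using hβ))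
    have hα0 : 1 - β ≠ 0 := by
      intro h
      have : β = 1 := by linear_combination -h
      subst this
      exact hqr (by simpa using hβ.symm)
    have hrr : r = (1 - β) • p + β • q := by
      have : r = p - β • (p - q) := by rw [← hβ]; abel
      rw [this]; module
    set v := linL a p with hv
    have hspan : ∀ b : Fin 3 → K, ∃ c : Fin 3 → K, b = ∑ i, c i • (![v, linL a τ, linL a ρ]) i := by
      intro b
      obtain ⟨D, hD⟩ := arb1 a arb (p - q) (sub_ne_zero.2 hpq) b
      obtain ⟨c, d, h1⟩ := hp D
      obtain ⟨c', d', h2⟩ := hq D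
      rw [diff_formula a D p q hL, h1, h2] at hD
      refine ⟨![c' - c, -d, d'], ?_⟩
      rw [← hD]
      simp only [Fin.sum_univ_three, Matrix.cons_val, map_add, map_smul, ← hL, ← hv]
      module
    have hind : LinearIndependent K ![v, linL a τ, linL a ρ] := by
      refine linearIndependent_of_top_le_span_of_card_eq_finrank ?_ (by simp)
      intro b _
      obtain ⟨c, hc⟩ := hspan b
      rw [hc]
      exact Submodule.sum_mem _ fun i _ => Submodule.smul_mem _ _ (Submodule.subset_span ⟨i, rfl⟩)
    have hind' : ∀ x y z : K, x • v + y • linL a τ + z • linL a ρ = 0 → x = 0 ∧ y = 0 ∧ z = 0 := by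
      intro x y z h
      have := Fintype.linearIndependent_iff.1 hind ![x, y, z] (by
        simpa [Fin.sum_univ_three] using h)
      exact ⟨this 0, this 1, this 2⟩
    have main : ∀ s t : K, ∃ x y z : K,
        ((1 - β) * s) • τ + (β * t) • ρ = x • p + y • q + z • θ := by
      intro s t
      obtain ⟨D, hD⟩ := arb1 a arb (p - q) (sub_ne_zero.2 hpq) ((-s) • linL a τ + t • linL a ρ)
      obtain ⟨c, d, h1⟩ := hp D
      obtain ⟨c', d', h2⟩ := hq D
      obtain ⟨c'', d'', h3⟩ := hr D
      rw [diff_formula a D p q hL, h1, h2] at hD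
      simp only [map_add, map_smul, ← hL, ← hv] at hD
      obtain ⟨e1, e2, e3⟩ := hind' (c' - c) (s - d) (d' - t) (by
        linear_combination (norm := module) hD)
      have hd : d = s := by linear_combination -e2
      have hd' : d' = t := by linear_combination e3
      subst hd hd'
      refine ⟨c'' * (1 - β) - (1 - β) * c + D β, c'' * β - β * c' - D β, d'', ?_⟩
      funext i
      have g1 := congr_fun h1 i
      have g2 := congr_fun h2 i
      have g3 := congr_fun h3 i
      have g4 := congr_fun hrr i
      have g5 := congr_arg D g4
      simp only [Pi.add_apply, Pi.smul_apply, smul_eq_mul, map_add, Derivation.leibniz,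
        map_sub, Derivation.map_one_eq_zero] at g1 g2 g3 g4 g5 ⊢
      rw [g3, g1, g2, g4] at g5
      linear_combination -g5
    obtain ⟨x1, y1, z1, h1⟩ := main (1 - β)⁻¹ 0
    obtain ⟨x2, y2, z2, h2⟩ := main 0 β⁻¹
    rw [mul_inv_cancel₀ hα0] at h1
    rw [mul_inv_cancel₀ hβ0] at h2
    have l1 := congr_arg (linL a) h1
    have l2 := congr_arg (linL a) h2
    simp only [map_add, map_smul, mul_zero, zero_smul, one_smul, add_zero, zero_add,
      ← hL, ← hv] at l1 l2
    have hz1 : z1 ≠ 0 := by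
      rintro rfl
      obtain ⟨_, e2, _⟩ := hind' (-x1 - y1) 1 0 (by
        linear_combination (norm := module) l1)
      exact one_ne_zero e2
    obtain ⟨_, e2, e3⟩ := hind' (z1 * (x2 + y2) - z2 * (x1 + y1)) z2 (-z1) (by
      rw [l1, l2]; module)
    exact hz1 (neg_eq_zero.1 e3)

end LinAlg

open MvPolynomial

theorem self_mem_tangentSpace {k : Type} [Field k] {n : ℕ} {I : Ideal (MvPolynomial (Fin n) k)}
    (hI : ∃ S : Set (MvPolynomial (Fin n) k), I = Ideal.span S ∧ ∀ g ∈ S, ∃ d, g.IsHomogeneous d)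
    {P : Fin n → k} (hP : P ∈ projZeros I) : P ∈ tangentSpace I P := by
  obtain ⟨S, rfl, hS⟩ := hI
  refine mem_tangentSpace_of_span S P P hP fun f hf => ?_
  obtain ⟨d, hd⟩ := hS f hf
  have h1 := congr_arg (eval P) hd.sum_X_mul_pderiv
  simp only [map_sum, map_mul, eval_X, map_nsmul] at h1
  rw [hP f (Ideal.subset_span hf), smul_zero] at h1
  rw [← h1]
  exact Finset.sum_congr rfl fun i _ => mul_comm _ _

theorem exists_tangent_vector {k : Type} [Field k] {n : ℕ} {I : Ideal (MvPolynomial (Fin n) k)}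
    (hI : ∃ S : Set (MvPolynomial (Fin n) k), I = Ideal.span S ∧ ∀ g ∈ S, ∃ d, g.IsHomogeneous d)
    (hsm : IsSmoothCurve I)
    {P : Fin n → k} (hP : P ∈ projZeros I) (hP0 : P ≠ 0) :
    ∃ τ ∈ tangentSpace I P, ∀ x ∈ tangentSpace I P, ∃ c d : k, x = c • P + d • τ := by
  have hfr := hsm P hP hP0
  have hPT := self_mem_tangentSpace hI hP
  have hne : ∃ τ ∈ tangentSpace I P, τ ∉ Submodule.span k {P} := by
    by_contra hno
    push Not at hno
    have h1 : tangentSpace I P ≤ Submodule.span k {P} := hno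
    have h2 := Submodule.finrank_mono h1
    have h3 := finrank_span_le_card (R := k) ({P} : Set (Fin n → k))
    simp at h3
    omega
  obtain ⟨τ, hτ, hτP⟩ := hne
  refine ⟨τ, hτ, ?_⟩
  have hli : LinearIndependent k ![P, τ] := by
    rw [LinearIndependent.pair_iff' hP0]
    intro c hc
    exact hτP (Submodule.mem_span_singleton.2 ⟨c, hc⟩)
  have hle : Submodule.span k (Set.range ![P, τ]) ≤ tangentSpace I P := by
    rw [Submodule.span_le]
    rintro _ ⟨i, rfl⟩
    fin_cases i
    · exact hPT
    · exact hτ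
  have heq := Submodule.eq_of_le_of_finrank_eq hle (by
    rw [finrank_span_eq_card hli, hfr]; simp)
  intro x hx
  rw [← heq] at hx
  obtain ⟨c, hc⟩ := (Submodule.mem_span_range_iff_exists_fun k).1 hx
  exact ⟨c 0, c 1, by rw [← hc]; simp [Fin.sum_univ_two]⟩

theorem hat_linL {k K : Type} [Field k] [Field K] [Algebra k K] {n : ℕ}
    (π : ((Fin 3 × Fin n → k) → k) →ₐ[k] K) (P : (Fin 3 × Fin n → k) → Fin n → k) :
    hat π (fun ω => linL ω (P ω)) = linL (fun s => π (fun ω => ω s)) (hat π P) := by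
  funext i
  simp only [hat, linL_apply, ← map_mul, ← map_sum]
  congr 1
  funext ω
  simp

theorem exists_good_projection {k : Type} [Field k] [CharZero k] {n : ℕ}
    {I : Ideal (MvPolynomial (Fin n) k)}
    (hI : ∃ S : Set (MvPolynomial (Fin n) k), I = Ideal.span S ∧ ∀ g ∈ S, ∃ d, g.IsHomogeneous d)
    (hsm : IsSmoothCurve I) (P0 : Fin n → k) :
    ∃ a : Fin 3 × Fin n → k,
      (∀ P ∈ projZeros I, P ≠ 0 → linL a P ≠ 0) ∧
      (∀ P ∈ projZeros I, P ≠ 0 → ∀ x ∈ tangentSpace I P, linL a x = 0 → x = 0) ∧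
      (∀ P ∈ projZeros I, ∀ Q ∈ projZeros I, ∀ R ∈ projZeros I, P ≠ 0 → Q ≠ 0 → R ≠ 0 →
        linL a P = linL a Q → linL a P = linL a R → P = Q ∨ P = R ∨ Q = R) ∧
      (∀ P ∈ projZeros I, ∀ Q ∈ projZeros I, P ≠ 0 → Q ≠ 0 → linL a P = linL a Q → P ≠ Q →
        ∀ l : Fin 3 → k, (∀ x ∈ tangentSpace I P, ∑ i, l i * linL a x i = 0) →
          (∀ x ∈ tangentSpace I Q, ∑ i, l i * linL a x i = 0) → l = 0) ∧
      (∀ Q ∈ projZeros I, Q ≠ 0 → linL a P0 = linL a Q → P0 = Q) := by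
  obtain ⟨U, K, _, _, π, hs, hπ, halg⟩ := exists_generic k (Fin 3 × Fin n)
  have arb := exists_derivation_of_algInd (fun s => π (fun ω => ω s)) halg
  set A : Fin 3 × Fin n → K := fun s => π (fun ω => ω s) with hA
  have tv : ∀ P : (Fin 3 × Fin n → k) → Fin n → k,
      (∀ᶠ ω in U, P ω ∈ projZeros I ∧ P ω ≠ 0) → ∃ τ : (Fin 3 × Fin n → k) → Fin n → k,
        (∀ᶠ ω in U, τ ω ∈ tangentSpace I (P ω)) ∧
        (∀ᶠ ω in U, ∀ x ∈ tangentSpace I (P ω), ∃ c d : k, x = c • P ω + d • τ ω) ∧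
        ∀ D : Derivation k K K, ∃ c d : K, (fun i => D (hat π P i)) = c • hat π P + d • hat π τ := by
    intro P hP
    have : ∀ᶠ ω in U, ∃ τ, τ ∈ tangentSpace I (P ω) ∧
        ∀ x ∈ tangentSpace I (P ω), ∃ c d : k, x = c • P ω + d • τ := by
      filter_upwards [hP] with ω hω
      obtain ⟨τ, h1, h2⟩ := exists_tangent_vector hI hsm hω.1 hω.2
      exact ⟨τ, h1, h2⟩
    obtain ⟨τ, hτ⟩ := this.choice
    refine ⟨τ, hτ.mono fun _ h => h.1, hτ.mono fun _ h => h.2, fun D => ?_⟩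
    exact hat_deriv π hs U hπ I P τ (hP.mono fun _ h => h.1) (hτ.mono fun _ h => h.2) D
  have hne : ∀ P Q : (Fin 3 × Fin n → k) → Fin n → k, (∀ᶠ ω in U, P ω ≠ Q ω) →
      hat π P ≠ hat π Q := by
    intro P Q h h'
    rw [hat_eq π U hπ] at h'
    obtain ⟨ω, h1, h2⟩ := (h.and h').exists
    exact h1 h2
  have heq : ∀ P Q : (Fin 3 × Fin n → k) → Fin n → k,
      (∀ᶠ ω in U, linL ω (P ω) = linL ω (Q ω)) → linL A (hat π P) = linL A (hat π Q) := by
    intro P Q h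
    rw [← hat_linL, ← hat_linL, hat_eq π U hπ]
    exact h
  have hz0 : hat π (fun _ => 0 : (Fin 3 × Fin n → k) → Fin n → k) = 0 := by
    funext i
    exact map_zero π
  have heq0 : ∀ P : (Fin 3 × Fin n → k) → Fin n → k,
      (∀ᶠ ω in U, linL ω (P ω) = 0) → linL A (hat π P) = 0 := by
    intro P h
    rw [heq P (fun _ => 0) (by simpa using h), hz0, map_zero]
  have G1 : ∀ᶠ a in U, ∀ P ∈ projZeros I, P ≠ 0 → linL a P ≠ 0 := by
    by_contra hcon
    rw [← Ultrafilter.eventually_not] at hcon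
    have : ∀ᶠ a in U, ∃ P, (P ∈ projZeros I ∧ P ≠ 0) ∧ linL a P = 0 := by
      filter_upwards [hcon] with a ha
      push Not at ha
      obtain ⟨P, h1, h2, h3⟩ := ha
      exact ⟨P, ⟨h1, h2⟩, h3⟩
    obtain ⟨P, hP⟩ := this.choice
    obtain ⟨τ, h1, h2, h3⟩ := tv P (hP.mono fun _ h => h.1)
    exact core1 A arb (hat π P) (hat π τ) (hat_ne_zero π U hπ P (hP.mono fun _ h => h.1.2))
      (heq0 P (hP.mono fun _ h => h.2)) h3
  have G2 : ∀ᶠ a in U, ∀ P ∈ projZeros I, P ≠ 0 → ∀ x ∈ tangentSpace I P,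
      linL a x = 0 → x = 0 := by
    by_contra hcon
    rw [← Ultrafilter.eventually_not] at hcon
    have : ∀ᶠ a in U, ∃ Px : (Fin n → k) × (Fin n → k), (Px.1 ∈ projZeros I ∧ Px.1 ≠ 0) ∧
        Px.2 ∈ tangentSpace I Px.1 ∧ linL a Px.2 = 0 ∧ Px.2 ≠ 0 ∧
        ∀ x ∈ tangentSpace I Px.1, ∃ c d : k, x = c • Px.1 + d • Px.2 := by
      filter_upwards [hcon, G1] with a ha hG1
      push Not at ha
      obtain ⟨P, h1, h2, x, h3, h4, h5⟩ := ha
      refine ⟨(P, x), ⟨h1, h2⟩, h3, h4, h5, ?_⟩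
      obtain ⟨τ, t1, t2⟩ := exists_tangent_vector hI hsm h1 h2
      obtain ⟨c, d, hx⟩ := t2 x h3
      have hd : d ≠ 0 := by
        rintro rfl
        rw [hx] at h4
        simp only [zero_smul, add_zero, map_smul, smul_eq_zero] at h4
        rcases h4 with rfl | h4
        · exact h5 (by simpa using hx)
        · exact hG1 P h1 h2 h4
      intro y hy
      obtain ⟨e, f, hy⟩ := t2 y hy
      refine ⟨e - f / d * c, f / d, ?_⟩
      simp only
      rw [hy, hx]
      have : f = f / d * d := by field_simp
      nth_rewrite 1 [this]
      module
    obtain ⟨Px, hP⟩ := this.choice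
    obtain ⟨S, hS, hSh⟩ := hI
    subst hS
    refine core2 A arb (hat π fun ω => (Px ω).1) (hat π fun ω => (Px ω).2)
      (hat_ne_zero π U hπ _ (hP.mono fun _ h => h.2.2.2.1))
      (heq0 _ (hP.mono fun _ h => h.2.2.1)) ?_ ?_
    · intro D
      exact hat_deriv π hs U hπ _ _ _ (hP.mono fun _ h => h.1.1) (hP.mono fun _ h => h.2.2.2.2) D
    · intro D c hD
      exact hat_deriv2 π hs U hπ S hSh _ _ (hP.mono fun _ h => h.1.1)
        (hP.mono fun _ h => h.2.1) (hP.mono fun _ h => h.2.2.2.2) D c hD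
  have G3 : ∀ᶠ a in U, ∀ P ∈ projZeros I, ∀ Q ∈ projZeros I, ∀ R ∈ projZeros I,
      P ≠ 0 → Q ≠ 0 → R ≠ 0 →
        linL a P = linL a Q → linL a P = linL a R → P = Q ∨ P = R ∨ Q = R := by
    by_contra hcon
    rw [← Ultrafilter.eventually_not] at hcon
    have : ∀ᶠ a in U, ∃ p : (Fin n → k) × (Fin n → k) × (Fin n → k),
        (p.1 ∈ projZeros I ∧ p.1 ≠ 0) ∧ (p.2.1 ∈ projZeros I ∧ p.2.1 ≠ 0) ∧
        (p.2.2 ∈ projZeros I ∧ p.2.2 ≠ 0) ∧ linL a p.1 = linL a p.2.1 ∧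
        linL a p.1 = linL a p.2.2 ∧ p.1 ≠ p.2.1 ∧ p.1 ≠ p.2.2 ∧ p.2.1 ≠ p.2.2 := by
      filter_upwards [hcon] with a ha
      push Not at ha
      obtain ⟨P, h1, Q, h2, R, h3, h4, h5, h6, h7, h8, h9, h10, h11⟩ := ha
      exact ⟨(P, Q, R), ⟨h1, h4⟩, ⟨h2, h5⟩, ⟨h3, h6⟩, h7, h8, h9, h10, h11⟩
    obtain ⟨p, hp⟩ := this.choice
    obtain ⟨τ, -, -, t1⟩ := tv (fun ω => (p ω).1) (hp.mono fun _ h => h.1)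
    obtain ⟨ρ, -, -, t2⟩ := tv (fun ω => (p ω).2.1) (hp.mono fun _ h => h.2.1)
    obtain ⟨θ, -, -, t3⟩ := tv (fun ω => (p ω).2.2) (hp.mono fun _ h => h.2.2.1)
    exact core3 A arb _ _ _ _ _ _ (hne _ _ (hp.mono fun _ h => h.2.2.2.2.2.1))
      (hne _ _ (hp.mono fun _ h => h.2.2.2.2.2.2.1)) (hne _ _ (hp.mono fun _ h => h.2.2.2.2.2.2.2))
      (heq _ _ (hp.mono fun _ h => h.2.2.2.1)) (heq _ _ (hp.mono fun _ h => h.2.2.2.2.1)) t1 t2 t3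
  have G4 : ∀ᶠ a in U, ∀ P ∈ projZeros I, ∀ Q ∈ projZeros I, P ≠ 0 → Q ≠ 0 →
      linL a P = linL a Q → P ≠ Q →
        ∀ l : Fin 3 → k, (∀ x ∈ tangentSpace I P, ∑ i, l i * linL a x i = 0) →
          (∀ x ∈ tangentSpace I Q, ∑ i, l i * linL a x i = 0) → l = 0 := by
    by_contra hcon
    rw [← Ultrafilter.eventually_not] at hcon
    have : ∀ᶠ a in U, ∃ p : (Fin n → k) × (Fin n → k) × (Fin 3 → k),
        (p.1 ∈ projZeros I ∧ p.1 ≠ 0) ∧ (p.2.1 ∈ projZeros I ∧ p.2.1 ≠ 0) ∧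
        linL a p.1 = linL a p.2.1 ∧ p.1 ≠ p.2.1 ∧
        (∀ x ∈ tangentSpace I p.1, ∑ i, p.2.2 i * linL a x i = 0) ∧
        (∀ x ∈ tangentSpace I p.2.1, ∑ i, p.2.2 i * linL a x i = 0) ∧ p.2.2 ≠ 0 := by
      filter_upwards [hcon] with a ha
      push Not at ha
      obtain ⟨P, h1, Q, h2, h4, h5, h7, h8, l, h9, h10, h11⟩ := ha
      exact ⟨(P, Q, l), ⟨h1, h4⟩, ⟨h2, h5⟩, h7, h8, h9, h10, h11⟩
    obtain ⟨p, hp⟩ := this.choice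
    obtain ⟨τ, t0, -, t1⟩ := tv (fun ω => (p ω).1) (hp.mono fun _ h => h.1)
    obtain ⟨ρ, r0, -, t2⟩ := tv (fun ω => (p ω).2.1) (hp.mono fun _ h => h.2.1)
    have hl : ∀ x : (Fin 3 × Fin n → k) → Fin n → k,
        (∀ᶠ ω in U, ∑ i, (p ω).2.2 i * linL ω (x ω) i = 0) →
        Fintype.linearCombination K (hat π fun ω => (p ω).2.2) (linL A (hat π x)) = 0 := by
      intro x hx
      rw [Fintype.linearCombination_apply, ← hat_linL]
      simp only [hat, smul_eq_mul, ← map_mul, ← map_sum]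
      rw [← map_zero π, hπ]
      filter_upwards [hx] with ω hω
      rw [Pi.zero_apply, ← hω]
      simp [mul_comm]
    refine core4 A arb _ _ _ _ (hne _ _ (hp.mono fun _ h => h.2.2.2.1))
      (heq _ _ (hp.mono fun _ h => h.2.2.1)) t1 t2
      (Fintype.linearCombination K (hat π fun ω => (p ω).2.2)) ?_ (hl _ ?_) (hl _ ?_) (hl _ ?_)
    · intro h0
      refine hat_ne_zero π U hπ (fun ω => (p ω).2.2) (hp.mono fun _ h => h.2.2.2.2.2.2) ?_
      funext i
      have := LinearMap.congr_fun h0 (Pi.single i 1)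
      simpa [Fintype.linearCombination_apply_single] using this
    · filter_upwards [hp] with ω h
      exact h.2.2.2.2.1 _ (self_mem_tangentSpace hI h.1.1)
    · filter_upwards [hp, t0] with ω h h'
      exact h.2.2.2.2.1 _ h'
    · filter_upwards [hp, r0] with ω h h'
      exact h.2.2.2.2.2.1 _ h'
  have G5 : ∀ᶠ a in U, ∀ Q ∈ projZeros I, Q ≠ 0 → linL a P0 = linL a Q → P0 = Q := by
    by_contra hcon
    rw [← Ultrafilter.eventually_not] at hcon
    have : ∀ᶠ a in U, ∃ Q : Fin n → k, (Q ∈ projZeros I ∧ Q ≠ 0) ∧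
        linL a P0 = linL a Q ∧ P0 ≠ Q := by
      filter_upwards [hcon] with a ha
      push Not at ha
      obtain ⟨Q, h1, h2, h3, h4⟩ := ha
      exact ⟨Q, ⟨h1, h2⟩, h3, h4⟩
    obtain ⟨Q, hQ⟩ := this.choice
    obtain ⟨τ, -, -, t1⟩ := tv Q (hQ.mono fun _ h => h.1)
    refine core5 A arb (hat π fun _ => P0) (hat π Q) _ (hne _ _ (hQ.mono fun _ h => h.2.2))
      (heq _ _ (hQ.mono fun _ h => h.2.1)) ?_ t1
    intro D
    funext i
    have : hat π (fun _ => P0) i = algebraMap k K (P0 i) := π.commutes (P0 i)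
    rw [this]
    simp
  obtain ⟨a, ⟨⟨⟨⟨h1, h2⟩, h3⟩, h4⟩, h5⟩⟩ := ((((G1.and G2).and G3).and G4).and G5).exists
  exact ⟨a, h1, h2, h3, h4, h5⟩

open MvPolynomial

theorem sup_sq_le_aux {A : Type} [CommRing A] (I Y : Ideal A) :
    I ⊔ (I ⊔ Y) ^ 2 ≤ I ⊔ Y * Y := by
  refine sup_le le_sup_left ?_
  rw [pow_two, Ideal.mul_le]
  intro x hx y hy
  obtain ⟨x1, h1, x2, h2, rfl⟩ := Submodule.mem_sup.1 hx
  obtain ⟨y1, h3, y2, h4, rfl⟩ := Submodule.mem_sup.1 hy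
  have : (x1 + x2) * (y1 + y2) = (x1 * (y1 + y2) + x2 * y1) + x2 * y2 := by ring
  rw [this]
  exact Ideal.add_mem _ (Ideal.mem_sup_left (Ideal.add_mem _ (Ideal.mul_mem_right _ _ h1)
    (Ideal.mul_mem_left _ _ h3))) (Ideal.mem_sup_right (Ideal.mul_mem_mul h2 h4))

section Fibre

variable {k : Type} [Field k] {n : ℕ}

/-- The maximal ideal of a point. -/
noncomputable def ptIdeal (P : Fin n → k) : Ideal (MvPolynomial (Fin n) k) := RingHom.ker (eval P)

theorem mem_ptIdeal (P : Fin n → k) (f : MvPolynomial (Fin n) k) :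
    f ∈ ptIdeal P ↔ eval P f = 0 := RingHom.mem_ker

theorem ptIdeal_isPrime (P : Fin n → k) : (ptIdeal P).IsPrime := RingHom.ker_isPrime _

theorem taylor1 (P : Fin n → k) (f : MvPolynomial (Fin n) k) :
    f - C (eval P f) - ∑ i, C (eval P (pderiv i f)) * (X i - C (P i)) ∈ ptIdeal P ^ 2 := by
  induction f using MvPolynomial.induction_on with
  | C c => simp
  | add p q hp hq =>
    have := Ideal.add_mem _ hp hq
    convert this using 1
    simp only [map_add, add_mul, Finset.sum_add_distrib]
    ring
  | mul_X p j hp =>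
    have hX : X j - C (P j) ∈ ptIdeal P := by rw [mem_ptIdeal]; simp
    have hp' : p - C (eval P p) ∈ ptIdeal P := by rw [mem_ptIdeal]; simp
    have h1 : (p - C (eval P p)) * (X j - C (P j)) ∈ ptIdeal P ^ 2 := by
      rw [pow_two]; exact Ideal.mul_mem_mul hp' hX
    have h2 := Ideal.add_mem _ (Ideal.mul_mem_left _ (C (P j)) hp) h1
    convert h2 using 1
    have h3 : ∀ i, C (eval P (pderiv i (p * X j))) * (X i - C (P i))
        = C (P j) * (C (eval P (pderiv i p)) * (X i - C (P i)))
          + C (eval P p) * ((Pi.single j 1 : Fin n → MvPolynomial (Fin n) k) i * (X i - C (P i))) := by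
      intro i
      rw [Derivation.leibniz, pderiv_X]
      by_cases hij : i = j
      · subst hij
        simp; ring
      · simp [Pi.single_apply, hij, Ne.symm hij]; ring
    simp only [h3, Finset.sum_add_distrib, ← Finset.mul_sum]
    have h4 : ∑ i, (Pi.single j 1 : Fin n → MvPolynomial (Fin n) k) i * (X i - C (P i))
        = X j - C (P j) := by
      rw [Finset.sum_eq_single j]
      · simp
      · intro b _ hb; simp [hb]
      · simp
    rw [h4]
    simp only [map_mul, eval_X]
    ring

theorem cotangent (I : Ideal (MvPolynomial (Fin n) k)) (P : Fin n → k) (hP : P ∈ projZeros I)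
    (f : MvPolynomial (Fin n) k) (h0 : eval P f = 0)
    (h : ∀ x ∈ tangentSpace I P, ∑ i, eval P (pderiv i f) * x i = 0) :
    f ∈ I ⊔ ptIdeal P ^ 2 := by
  let d : MvPolynomial (Fin n) k →ₗ[k] (Fin n → k) :=
    LinearMap.pi fun i => (aeval P : MvPolynomial (Fin n) k →ₐ[k] k).toLinearMap.comp
      (pderiv i).toLinearMap
  have hd : ∀ g i, d g i = eval P (pderiv i g) := fun g i => by
    simp [d, aeval_eq_eval]
  have hmem : d f ∈ (I.restrictScalars k).map d := by
    by_contra hno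
    obtain ⟨φ, hφ, hker⟩ := Submodule.exists_le_ker_of_notMem hno
    have hφs : ∀ y : Fin n → k, φ y = ∑ i, y i * φ (Pi.single i 1) := by
      intro y
      conv_lhs => rw [← Finset.univ_sum_single y]
      rw [map_sum]
      refine Finset.sum_congr rfl fun i _ => ?_
      rw [← smul_eq_mul, ← map_smul, ← Pi.single_smul]; simp
    refine hφ ?_
    rw [hφs]
    simp only [hd]
    refine h _ ((mem_tangentSpace _ _ _).2 fun g hg => ?_)
    have := hker (Submodule.mem_map_of_mem (f := d) (p := I.restrictScalars k) hg)
    rw [LinearMap.mem_ker, hφs] at this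
    simpa only [hd] using this
  obtain ⟨g, hg, hgf⟩ := hmem
  have hgI : g ∈ I := hg
  have : f = g + (f - g) := by ring
  rw [this]
  refine Ideal.add_mem _ (Ideal.mem_sup_left hgI) (Ideal.mem_sup_right ?_)
  have ht := taylor1 P (f - g)
  have e1 : eval P (f - g) = 0 := by rw [map_sub, h0, hP g hgI, sub_zero]
  have e2 : ∀ i, eval P (pderiv i (f - g)) = 0 := by
    intro i
    rw [map_sub, map_sub, ← hd, ← hd, hgf, sub_self]
  simpa only [e1, e2, C_0, zero_mul, Finset.sum_const_zero, sub_zero] using ht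

/-- The coordinate forms of the projection. -/
noncomputable def ell (a : Fin 3 × Fin n → k) (i : Fin 3) : MvPolynomial (Fin n) k :=
  ∑ j, C (a (i, j)) * X j

theorem eval_ell (a : Fin 3 × Fin n → k) (i : Fin 3) (P : Fin n → k) :
    eval P (ell a i) = linL a P i := by
  simp [ell, linL_apply]

theorem eval_bind_ell (a : Fin 3 × Fin n → k) (r : MvPolynomial (Fin 3) k) (P : Fin n → k) :
    eval P (bind₁ (ell a) r) = eval (linL a P) r := by
  rw [eval, eval₂Hom_bind₁]
  congr 2
  funext i
  exact eval_ell a i P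

theorem sum_pderiv_ell (a : Fin 3 × Fin n → k) (i : Fin 3) (P x : Fin n → k) :
    ∑ j, eval P (pderiv j (ell a i)) * x j = linL a x i := by
  rw [linL_apply]
  refine Finset.sum_congr rfl fun j _ => ?_
  congr 1
  simp only [ell, map_sum, Derivation.leibniz, pderiv_C, smul_zero, add_zero, pderiv_X, smul_eq_mul,
    map_mul, eval_C]
  rw [Finset.sum_eq_single j]
  · simp
  · intro b _ hb; simp [Ne.symm hb, Pi.single_apply, hb]
  · simp

/-- The shifted forms. -/
noncomputable def yy (a : Fin 3 × Fin n → k) (v : Fin 3 → k) (i : Fin 3) :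
    MvPolynomial (Fin n) k := ell a i - C (v i)

/-- Ideal of the fibre over `v`. -/
noncomputable def fibIdeal (I : Ideal (MvPolynomial (Fin n) k)) (a : Fin 3 × Fin n → k)
    (v : Fin 3 → k) : Ideal (MvPolynomial (Fin n) k) := I ⊔ Ideal.span (Set.range (yy a v))

theorem eval_yy (a : Fin 3 × Fin n → k) (v : Fin 3 → k) (i : Fin 3) (P : Fin n → k) :
    eval P (yy a v i) = linL a P i - v i := by
  simp [yy, eval_ell]

theorem mem_fib (I : Ideal (MvPolynomial (Fin n) k)) (a : Fin 3 × Fin n → k)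
    (v : Fin 3 → k) (P : Fin n → k) :
    fibIdeal I a v ≤ ptIdeal P ↔ P ∈ projZeros I ∧ linL a P = v := by
  rw [fibIdeal, sup_le_iff, Ideal.span_le]
  refine and_congr Iff.rfl ?_
  constructor
  · intro h
    funext i
    have := h ⟨i, rfl⟩
    rw [SetLike.mem_coe, mem_ptIdeal, eval_yy] at this
    exact sub_eq_zero.1 this
  · rintro rfl _ ⟨i, rfl⟩
    rw [SetLike.mem_coe, mem_ptIdeal, eval_yy, sub_self]

/-- `L` is immersive at `P`: cotangent version of the local statement. -/
theorem pt_le (I : Ideal (MvPolynomial (Fin n) k)) (a : Fin 3 × Fin n → k)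
    (v : Fin 3 → k) (P : Fin n → k) (hP : P ∈ projZeros I) (hv : linL a P = v)
    (hinj : ∀ x ∈ tangentSpace I P, linL a x = 0 → x = 0) :
    ptIdeal P ≤ fibIdeal I a v ⊔ ptIdeal P • ptIdeal P := by
  intro f hf
  rw [mem_ptIdeal] at hf
  have hker : LinearMap.ker ((linL a).domRestrict (tangentSpace I P)) = ⊥ := by
    rw [LinearMap.ker_eq_bot']
    rintro ⟨x, hx⟩ h
    exact Subtype.ext (hinj x hx h)
  obtain ⟨g, hg⟩ := LinearMap.exists_leftInverse_of_injective _ hker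
  let l : Fin 3 → k := fun i => ∑ j, eval P (pderiv j f) * (g (Pi.single i 1) : Fin n → k) j
  have hl : ∀ x ∈ tangentSpace I P, ∑ j, eval P (pderiv j f) * x j = ∑ i, l i * linL a x i := by
    intro x hx
    have h1 : g (linL a x) = ⟨x, hx⟩ := LinearMap.congr_fun hg ⟨x, hx⟩
    have h2 : x = ∑ i, linL a x i • (g (Pi.single i 1) : Fin n → k) := by
      have h3 := congr_arg (Subtype.val) h1
      rw [← Finset.univ_sum_single (linL a x), map_sum] at h3
      simp only [AddSubmonoidClass.coe_finsetSum] at h3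
      conv_lhs => rw [← h3]
      refine Finset.sum_congr rfl fun i _ => ?_
      rw [← Submodule.coe_smul, ← map_smul, ← Pi.single_smul]; simp
    conv_lhs => rw [h2]
    simp only [Finset.sum_apply, Pi.smul_apply, smul_eq_mul, Finset.mul_sum, l, Finset.sum_mul]
    rw [Finset.sum_comm]
    exact Finset.sum_congr rfl fun i _ => Finset.sum_congr rfl fun j _ => by ring
  have key := cotangent I P hP (f - ∑ i, C (l i) * yy a v i) (by
    simp [hf, eval_yy, hv]) (by
    intro x hx
    have e1 : ∀ j, pderiv j (f - ∑ i, C (l i) * yy a v i)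
        = pderiv j f - ∑ i, C (l i) * pderiv j (ell a i) := by
      intro j
      simp [yy, Derivation.leibniz]
    simp only [e1, map_sub, sub_mul, Finset.sum_sub_distrib, map_sum, map_mul, eval_C]
    rw [hl x hx, sub_eq_zero]
    simp only [← sum_pderiv_ell a _ P x, Finset.mul_sum, Finset.sum_mul]
    rw [Finset.sum_comm]
    exact Finset.sum_congr rfl fun i _ => Finset.sum_congr rfl fun j _ => by ring)
  have : f = (f - ∑ i, C (l i) * yy a v i) + ∑ i, C (l i) * yy a v i := by ring
  rw [this]
  refine Ideal.add_mem _ ?_ (Ideal.mem_sup_left (Ideal.mem_sup_right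
    (Ideal.sum_mem _ fun i _ => Ideal.mul_mem_left _ _ (Ideal.subset_span ⟨i, rfl⟩))))
  rw [pow_two] at key
  exact (sup_le_sup_right le_sup_left _ : I ⊔ ptIdeal P * ptIdeal P ≤ _) key

theorem exists_local (I : Ideal (MvPolynomial (Fin n) k)) (a : Fin 3 × Fin n → k)
    (v : Fin 3 → k) (P : Fin n → k) (hP : P ∈ projZeros I) (hv : linL a P = v)
    (hinj : ∀ x ∈ tangentSpace I P, linL a x = 0 → x = 0) :
    ∃ r ∉ ptIdeal P, ∀ f ∈ ptIdeal P, r * f ∈ fibIdeal I a v := by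
  obtain ⟨r, hr, hle⟩ := Submodule.exists_sub_one_mem_and_smul_le_of_fg_of_le_sup
    (IsNoetherian.noetherian (ptIdeal P)) le_rfl (pt_le I a v P hP hv hinj)
  refine ⟨r, fun h => ?_, fun f hf => hle (Submodule.smul_mem_pointwise_smul f r _ hf)⟩
  have : (1 : MvPolynomial (Fin n) k) ∈ ptIdeal P := by
    have := Ideal.sub_mem _ h hr
    simpa using this
  exact (ptIdeal_isPrime P).ne_top ((Ideal.eq_top_iff_one _).2 this)

theorem mem_of_local [IsAlgClosed k] (J : Ideal (MvPolynomial (Fin n) k))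
    (f : MvPolynomial (Fin n) k)
    (h : ∀ P, J ≤ ptIdeal P → ∃ r ∉ ptIdeal P, r * f ∈ J) : f ∈ J := by
  by_contra hf
  have hne : J.colon {f} ≠ ⊤ := by
    intro htop
    rw [Ideal.eq_top_iff_one, Submodule.mem_colon_singleton] at htop
    exact hf (by simpa using htop)
  obtain ⟨M, hM, hle⟩ := Ideal.exists_le_maximal _ hne
  obtain ⟨P, rfl⟩ := (isMaximal_iff_eq_vanishingIdeal_singleton).1 hM
  have hPM : (vanishingIdeal k {P} : Ideal (MvPolynomial (Fin n) k)) = ptIdeal P := by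
    ext g
    rw [mem_vanishingIdeal_singleton_iff, mem_ptIdeal, aeval_eq_eval]
  rw [hPM] at hle
  obtain ⟨r, hr, hrf⟩ := h P (fun g hg => hle (by
    rw [Submodule.mem_colon_singleton]
    exact Ideal.mul_mem_right _ _ hg))
  exact hr (hle (by rw [Submodule.mem_colon_singleton]; exact hrf))

theorem mem_fib_of_vanish [IsAlgClosed k] (I : Ideal (MvPolynomial (Fin n) k))
    (a : Fin 3 × Fin n → k) (v : Fin 3 → k) (hv0 : v ≠ 0)
    (hinj : ∀ P ∈ projZeros I, P ≠ 0 → ∀ x ∈ tangentSpace I P, linL a x = 0 → x = 0)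
    (f : MvPolynomial (Fin n) k) (hf : ∀ P ∈ projZeros I, linL a P = v → eval P f = 0) :
    f ∈ fibIdeal I a v := by
  refine mem_of_local _ f fun P hP => ?_
  rw [mem_fib] at hP
  have hP0 : P ≠ 0 := by
    rintro rfl
    exact hv0 (by rw [← hP.2, map_zero])
  obtain ⟨r, hr, h⟩ := exists_local I a v P hP.1 hP.2 (hinj P hP.1 hP0)
  exact ⟨r, hr, h f ((mem_ptIdeal _ _).2 (hf P hP.1 hP.2))⟩

theorem exists_syzygy [IsAlgClosed k] (I : Ideal (MvPolynomial (Fin n) k))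
    (a : Fin 3 × Fin n → k) (v : Fin 3 → k) (hv0 : v ≠ 0)
    (hinj : ∀ P ∈ projZeros I, P ≠ 0 → ∀ x ∈ tangentSpace I P, linL a x = 0 → x = 0)
    (B : Fin 3 → MvPolynomial (Fin n) k)
    (hB : ∀ P ∈ projZeros I, linL a P = v →
      ∀ x ∈ tangentSpace I P, ∑ i, eval P (B i) * linL a x i = 0) :
    ∃ A : Fin 3 → MvPolynomial (Fin n) k, ∑ i, A i * yy a v i ∈ I ∧
      ∀ P, linL a P = v → ∀ i, eval P (A i) = eval P (B i) := by
  have h1 : ∑ i, B i * yy a v i ∈ I ⊔ fibIdeal I a v ^ 2 := by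
    refine mem_of_local _ _ fun P hP => ?_
    have hP' : fibIdeal I a v ≤ ptIdeal P :=
      (ptIdeal_isPrime P).le_of_pow_le (le_sup_right.trans hP)
    rw [mem_fib] at hP'
    have hP0 : P ≠ 0 := by
      rintro rfl
      exact hv0 (by rw [← hP'.2, map_zero])
    obtain ⟨r, hr, h⟩ := exists_local I a v P hP'.1 hP'.2 (hinj P hP'.1 hP0)
    refine ⟨r ^ 2, fun hc => hr ((ptIdeal_isPrime P).mem_of_pow_mem _ hc), ?_⟩
    have h2 := cotangent I P hP'.1 (∑ i, B i * yy a v i) (by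
      simp [eval_yy, hP'.2]) (by
      intro x hx
      rw [← hB P hP'.1 hP'.2 x hx]
      have e1 : ∀ j, eval P (pderiv j (∑ i, B i * yy a v i))
          = ∑ i, eval P (B i) * eval P (pderiv j (ell a i)) := by
        intro j
        simp only [map_sum, Derivation.leibniz, map_add, smul_eq_mul, map_mul, eval_yy, hP'.2,
          sub_self, zero_mul, add_zero, yy, map_sub, pderiv_C, sub_zero, eval_ell, eval_C]
      simp only [e1, ← sum_pderiv_ell a _ P x, Finset.mul_sum, Finset.sum_mul]
      rw [Finset.sum_comm]
      exact Finset.sum_congr rfl fun i _ => Finset.sum_congr rfl fun j _ => by ring)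
    obtain ⟨g, hg, m, hm, hgm⟩ := Submodule.mem_sup.1 h2
    rw [← hgm, mul_add]
    refine Ideal.add_mem _ (Ideal.mem_sup_left (Ideal.mul_mem_left _ _ hg)) (Ideal.mem_sup_right ?_)
    have h3 : Ideal.span {r} * ptIdeal P ≤ fibIdeal I a v := by
      rw [Ideal.span_singleton_mul_le_iff]
      exact h
    have h4 := Ideal.pow_right_mono h3 2
    rw [mul_pow, Ideal.span_singleton_pow, Ideal.span_singleton_mul_le_iff] at h4
    exact h4 m hm
  have h2 : I ⊔ fibIdeal I a v ^ 2 ≤ I ⊔ Ideal.span (Set.range (yy a v)) * Ideal.span (Set.range (yy a v)) := by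
    exact sup_sq_le_aux I _
  obtain ⟨g, hg, m, hm, hgm⟩ := Submodule.mem_sup.1 (h2 h1)
  have h3 : ∃ b : Fin 3 → MvPolynomial (Fin n) k,
      (∀ i, b i ∈ Ideal.span (Set.range (yy a v))) ∧ m = ∑ i, b i * yy a v i := by
    rw [← smul_eq_mul] at hm
    obtain ⟨b, hb, hbs⟩ := (Submodule.mem_ideal_smul_span_iff_exists_sum _ (yy a v) m).1 hm
    refine ⟨b, hb, ?_⟩
    rw [← hbs, Finsupp.sum_fintype]
    · rfl
    · simp
  obtain ⟨b, hb, hmb⟩ := h3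
  refine ⟨fun i => B i - b i, ?_, ?_⟩
  · have : ∑ i, (B i - b i) * yy a v i = g := by
      simp only [sub_mul, Finset.sum_sub_distrib, ← hmb, ← hgm]; ring
    rw [this]; exact hg
  · intro P hP i
    have : eval P (b i) = 0 := by
      have hle : Ideal.span (Set.range (yy a v)) ≤ ptIdeal P := by
        rw [Ideal.span_le]
        rintro _ ⟨i, rfl⟩
        rw [SetLike.mem_coe, mem_ptIdeal, eval_yy, hP, sub_self]
      exact (mem_ptIdeal _ _).1 (hle (hb i))
    rw [map_sub, this, sub_zero]

end Fibre

open MvPolynomial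

section Fin6

variable {k : Type} [Field k] {n : ℕ}

theorem homComp_mem {I : Ideal (MvPolynomial (Fin n) k)}
    (hI : ∃ S : Set (MvPolynomial (Fin n) k), I = Ideal.span S ∧ ∀ g ∈ S, ∃ d, g.IsHomogeneous d)
    {f : MvPolynomial (Fin n) k} (hf : f ∈ I) (e : ℕ) : homogeneousComponent e f ∈ I := by
  obtain ⟨S, rfl, hS⟩ := hI
  letI := MvPolynomial.gradedAlgebra (σ := Fin n) (R := k)
  exact homogeneousComponent_mem_of_mem (Ideal.homogeneous_span _ S fun g hg => hS g hg) hf e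

theorem homComp_mul {σ : Type} (f g : MvPolynomial σ k) (e d : ℕ) (hg : g.IsHomogeneous d) :
    homogeneousComponent (e + d) (f * g) = homogeneousComponent e f * g := by
  conv_lhs => rw [← sum_homogeneousComponent f, Finset.sum_mul, map_sum]
  have : ∀ i, homogeneousComponent (e + d) (homogeneousComponent i f * g)
      = if i = e then homogeneousComponent e f * g else 0 := by
    intro i
    rw [homogeneousComponent_of_mem ((homogeneousComponent_isHomogeneous i f).mul hg)]
    by_cases h : i = e
    · simp [h]
    · rw [if_neg h, if_neg (by omega)]
  simp only [this, Finset.sum_ite_eq', Finset.mem_range]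
  split_ifs with h
  · rfl
  · rw [homogeneousComponent_eq_zero _ _ (by omega), zero_mul]

theorem ell_homog (a : Fin 3 × Fin n → k) (i : Fin 3) : (ell a i).IsHomogeneous 1 :=
  IsHomogeneous.sum _ _ _ fun j _ => isHomogeneous_C_mul_X _ _

theorem homComp_bind (a : Fin 3 × Fin n → k) (r : MvPolynomial (Fin 3) k) (e : ℕ) :
    homogeneousComponent e (bind₁ (ell a) r) = bind₁ (ell a) (homogeneousComponent e r) := by
  conv_lhs => rw [← sum_homogeneousComponent r, map_sum, map_sum]
  have : ∀ i, homogeneousComponent e (bind₁ (ell a) (homogeneousComponent i r))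
      = if i = e then bind₁ (ell a) (homogeneousComponent e r) else 0 := by
    intro i
    have h := (homogeneousComponent_isHomogeneous i r).aeval (ell a) (ell_homog a)
    rw [one_mul] at h
    have h' : (bind₁ (ell a) (homogeneousComponent i r)).IsHomogeneous i := h
    rw [homogeneousComponent_of_mem h']
    by_cases hi : i = e
    · simp [hi]
    · rw [if_neg hi, if_neg (Ne.symm hi)]
  simp only [this, Finset.sum_ite_eq', Finset.mem_range]
  split_ifs with h
  · rfl
  · rw [homogeneousComponent_eq_zero _ _ (by omega), map_zero]

/-- The map on coordinate rings. -/
noncomputable def theta (I : Ideal (MvPolynomial (Fin n) k)) (a : Fin 3 × Fin n → k) :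
    MvPolynomial (Fin 3) k →+* MvPolynomial (Fin n) k ⧸ I :=
  (Ideal.Quotient.mk I).comp (bind₁ (ell a) : MvPolynomial (Fin 3) k →ₐ[k] _).toRingHom

theorem theta_apply (I : Ideal (MvPolynomial (Fin n) k)) (a : Fin 3 × Fin n → k)
    (r : MvPolynomial (Fin 3) k) : theta I a r = Ideal.Quotient.mk I (bind₁ (ell a) r) := rfl

theorem mem_ker_theta (I : Ideal (MvPolynomial (Fin n) k)) (a : Fin 3 × Fin n → k)
    (r : MvPolynomial (Fin 3) k) : r ∈ RingHom.ker (theta I a) ↔ bind₁ (ell a) r ∈ I := by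
  rw [RingHom.mem_ker, theta_apply, Ideal.Quotient.eq_zero_iff_mem]

theorem finite_of_closed {R S : Type} [CommRing R] [CommRing S] (θ : R →+* S) (W : Finset S)
    (h : ∀ N : AddSubmonoid S, (∀ w ∈ W, w ∈ N) → (∀ r, ∀ x ∈ N, θ r * x ∈ N) → ∀ x, x ∈ N) :
    θ.Finite := by
  letI := θ.toAlgebra
  refine ⟨⟨W, ?_⟩⟩
  rw [eq_top_iff]
  rintro x -
  refine h (Submodule.span R (W : Set S)).toAddSubmonoid (fun w hw => Submodule.subset_span hw)
    (fun r x hx => ?_) x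
  have := Submodule.smul_mem (Submodule.span R (W : Set S)) r hx
  rwa [Algebra.smul_def] at this

theorem nakayama_abs {R S : Type} [CommRing R] [CommRing S] (θ : R →+* S) (hθ : θ.Finite)
    (M : Ideal R) {m : ℕ} (e : Fin m → S)
    (h : ∀ x, ∃ r : Fin m → R, x - ∑ i, θ (r i) * e i ∈ M.map θ) :
    ∃ c, c - 1 ∈ M ∧ ∀ x, ∃ r : Fin m → R, θ c * x = ∑ i, θ (r i) * e i := by
  letI := θ.toAlgebra
  haveI : Module.Finite R S := hθ
  have hsm : ∀ (r : R) (x : S), r • x = θ r * x := fun r x => Algebra.smul_def r x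
  obtain ⟨c, hc, hcN⟩ := Submodule.exists_sub_one_mem_and_smul_le_of_fg_of_le_sup
    (I := M) (N := Submodule.span R (Set.range e)) (N' := (⊤ : Submodule R S)) (P := ⊤)
    Module.Finite.fg_top le_top (by
      rintro x -
      obtain ⟨r, hr⟩ := h x
      rw [← sub_add_cancel x (∑ i, θ (r i) * e i), add_comm]
      refine Submodule.add_mem_sup ?_ ?_
      · refine Submodule.sum_mem _ fun i _ => ?_
        rw [← hsm]
        exact Submodule.smul_mem _ _ (Submodule.subset_span ⟨i, rfl⟩)
      · rw [Ideal.smul_top_eq_map]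
        exact hr)
  refine ⟨c, hc, fun x => ?_⟩
  have hx : c • x ∈ Submodule.span R (Set.range e) :=
    hcN (Submodule.smul_mem_pointwise_smul x c ⊤ trivial)
  rw [Submodule.mem_span_range_iff_exists_fun] at hx
  obtain ⟨r, hr⟩ := hx
  exact ⟨r, by rw [← hsm, ← hr]; exact Finset.sum_congr rfl fun i _ => (hsm _ _).symm⟩

theorem theta_finite [IsAlgClosed k] {I : Ideal (MvPolynomial (Fin n) k)}
    (hI : ∃ S : Set (MvPolynomial (Fin n) k), I = Ideal.span S ∧ ∀ g ∈ S, ∃ d, g.IsHomogeneous d)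
    (a : Fin 3 × Fin n → k) (G1 : ∀ P ∈ projZeros I, P ≠ 0 → linL a P ≠ 0) :
    (theta I a).Finite := by
  classical
  set J0 := I ⊔ Ideal.span (Set.range (ell a)) with hJ0
  have hrad : idealOfVars (Fin n) k ≤ J0.radical := by
    rw [← vanishingIdeal_zeroLocus_eq_radical (K := k), idealOfVars, Ideal.span_le]
    rintro _ ⟨j, rfl⟩
    rw [SetLike.mem_coe, mem_vanishingIdeal_iff]
    intro P hP
    rw [mem_zeroLocus_iff] at hP
    have h0 : P = 0 := by
      by_contra hne
      refine G1 P (fun f hf => ?_) hne ?_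
      · simpa [aeval_eq_eval] using hP f (Ideal.mem_sup_left hf)
      · funext i
        rw [← eval_ell]
        simpa [aeval_eq_eval] using hP (ell a i) (Ideal.mem_sup_right (Ideal.subset_span ⟨i, rfl⟩))
    simp [h0]
  obtain ⟨D, hD⟩ := Ideal.exists_pow_le_of_le_radical_of_fg hrad (idealOfVars_fg _ _)
  choose T hT using fun e => homogeneousSubmodule_fg (R := k) (σ := Fin n) e
  refine finite_of_closed _ (((Finset.range (D + 1)).biUnion T).image (Ideal.Quotient.mk I)) ?_
  intro N hW hN
  have key : ∀ e, ∀ f : MvPolynomial (Fin n) k, f.IsHomogeneous e →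
      Ideal.Quotient.mk I f ∈ N := by
    intro e
    induction e using Nat.strong_induction_on with
    | _ e ih =>
    intro f hf
    by_cases he : e < D + 1
    · have hf' : f ∈ Submodule.span k (T e : Set (MvPolynomial (Fin n) k)) := by
        rw [hT e]; exact hf
      refine Submodule.span_induction (p := fun x _ => Ideal.Quotient.mk I x ∈ N)
        ?_ ?_ ?_ ?_ hf'
      · intro x hx
        exact hW _ (Finset.mem_image_of_mem _
          (Finset.mem_biUnion.2 ⟨e, Finset.mem_range.2 he, hx⟩))
      · rw [map_zero]; exact N.zero_mem
      · intro x y _ _ hx hy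
        rw [map_add]; exact N.add_mem hx hy
      · intro c x _ hx
        have := hN (C c) _ hx
        rw [theta_apply, ← map_mul, bind₁_C_right, ← smul_eq_C_mul] at this
        exact this
    · have hfJ : f ∈ J0 := hD ((mem_pow_idealOfVars_iff D f).2 (by
        intro x hx
        have h1 := hf (mem_support_iff.1 hx)
        rw [Finsupp.degree_eq_weight_one]
        change D ≤ Finsupp.weight 1 x
        omega))
      obtain ⟨g, hg, y, hy, hgy⟩ := Submodule.mem_sup.1 hfJ
      obtain ⟨h, rfl⟩ := (Ideal.mem_span_range_iff_exists_fun).1 hy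
      obtain ⟨e', rfl⟩ : ∃ e', e = e' + 1 := ⟨e - 1, by omega⟩
      have h2 : homogeneousComponent (e' + 1) f = f := by
        rw [homogeneousComponent_of_mem hf, if_pos rfl]
      rw [← h2, ← hgy, map_add, map_sum, map_add, map_sum,
        Ideal.Quotient.eq_zero_iff_mem.2 (homComp_mem hI hg _), zero_add]
      refine N.sum_mem fun i _ => ?_
      rw [homComp_mul _ _ _ _ (ell_homog a i), mul_comm]
      have := hN (X i) _ (ih e' (by omega) _ (homogeneousComponent_isHomogeneous e' (h i)))
      rw [theta_apply, ← map_mul, bind₁_X_right] at this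
      exact this
  intro x
  obtain ⟨f, rfl⟩ := Ideal.Quotient.mk_surjective x
  rw [← sum_homogeneousComponent f, map_sum]
  exact N.sum_mem fun i _ => key i _ (homogeneousComponent_isHomogeneous i f)

theorem fibre_nakayama [IsAlgClosed k] (I : Ideal (MvPolynomial (Fin n) k))
    (a : Fin 3 × Fin n → k) (hfin : (theta I a).Finite) (v : Fin 3 → k) (hv0 : v ≠ 0)
    (hinj : ∀ P ∈ projZeros I, P ≠ 0 → ∀ x ∈ tangentSpace I P, linL a x = 0 → x = 0)
    {m : ℕ} (pts : Fin m → (Fin n → k)) (e : Fin m → MvPolynomial (Fin n) k)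
    (hpts : ∀ P ∈ projZeros I, linL a P = v → ∃ i, P = pts i)
    (he : ∀ i j, eval (pts i) (e j) = if i = j then 1 else 0) :
    ∃ c : MvPolynomial (Fin 3) k, eval v c = 1 ∧ ∀ f, ∃ r : Fin m → MvPolynomial (Fin 3) k,
      bind₁ (ell a) c * f - ∑ i, bind₁ (ell a) (r i) * e i ∈ I := by
  obtain ⟨c, hc, h⟩ := nakayama_abs (theta I a) hfin (ptIdeal v)
    (fun i => Ideal.Quotient.mk I (e i)) (by
      intro x
      obtain ⟨f, rfl⟩ := Ideal.Quotient.mk_surjective x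
      refine ⟨fun i => C (eval (pts i) f), ?_⟩
      have hf : f - ∑ i, C (eval (pts i) f) * e i ∈ fibIdeal I a v := by
        refine mem_fib_of_vanish I a v hv0 hinj _ ?_
        intro P hP hPv
        obtain ⟨i, rfl⟩ := hpts P hP hPv
        simp [he]
      have : (fibIdeal I a v).map (Ideal.Quotient.mk I) ≤ (ptIdeal v).map (theta I a) := by
        rw [fibIdeal, Ideal.map_sup, Ideal.map_quotient_self, bot_sup_eq, Ideal.map_span,
          Ideal.span_le]
        rintro _ ⟨_, ⟨i, rfl⟩, rfl⟩
        have h1 : (X i - C (v i) : MvPolynomial (Fin 3) k) ∈ ptIdeal v := by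
          simp [mem_ptIdeal]
        have h2 := Ideal.mem_map_of_mem (theta I a) h1
        rw [theta_apply, map_sub, bind₁_X_right, bind₁_C_right] at h2
        exact h2
      have h3 := this (Ideal.mem_map_of_mem _ hf)
      rw [map_sub, map_sum] at h3
      simpa only [theta_apply, bind₁_C_right, map_mul] using h3)
  refine ⟨c, ?_, fun f => ?_⟩
  · rw [mem_ptIdeal] at hc
    simpa [sub_eq_zero] using hc
  · obtain ⟨r, hr⟩ := h (Ideal.Quotient.mk I f)
    refine ⟨r, ?_⟩
    rw [← Ideal.Quotient.eq_zero_iff_mem, map_sub, sub_eq_zero, map_sum, map_mul]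
    simpa only [theta_apply, map_mul] using hr

end Fin6

open MvPolynomial

section Fib7

variable {k : Type} [Field k] {n : ℕ}

theorem exists_perp (u w : Fin 3 → k) :
    ∃ l : Fin 3 → k, l ≠ 0 ∧ ∑ i, l i * u i = 0 ∧ ∑ i, l i * w i = 0 := by
  obtain ⟨l, hl, h⟩ := (Matrix.exists_mulVec_eq_zero_iff (M := Matrix.of ![u, w, 0])).2
    (Matrix.det_eq_zero_of_row_eq_zero 2 (fun j => by simp))
  have h0 := congrFun h 0
  have h1 := congrFun h 1
  simp [Matrix.mulVec, dotProduct] at h0 h1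
  refine ⟨l, hl, ?_, ?_⟩
  · rw [← h0]; exact Finset.sum_congr rfl fun i _ => mul_comm _ _
  · rw [← h1]; exact Finset.sum_congr rfl fun i _ => mul_comm _ _

theorem exists_conormal {I : Ideal (MvPolynomial (Fin n) k)}
    (hI : ∃ S : Set (MvPolynomial (Fin n) k), I = Ideal.span S ∧ ∀ g ∈ S, ∃ d, g.IsHomogeneous d)
    (hsm : IsSmoothCurve I) (a : Fin 3 × Fin n → k) {P : Fin n → k} (hP : P ∈ projZeros I)
    (hP0 : P ≠ 0) :
    ∃ l : Fin 3 → k, l ≠ 0 ∧ ∀ x ∈ tangentSpace I P, ∑ i, l i * linL a x i = 0 := by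
  obtain ⟨τ, -, h⟩ := exists_tangent_vector hI hsm hP hP0
  obtain ⟨l, hl, h1, h2⟩ := exists_perp (linL a P) (linL a τ)
  refine ⟨l, hl, fun x hx => ?_⟩
  obtain ⟨c, d, rfl⟩ := h x hx
  simp only [map_add, map_smul, Pi.add_apply, Pi.smul_apply, smul_eq_mul, mul_add,
    Finset.sum_add_distrib]
  have e1 : ∑ i, l i * (c * linL a P i) = c * ∑ i, l i * linL a P i := by
    rw [Finset.mul_sum]; exact Finset.sum_congr rfl fun i _ => by ring
  have e2 : ∑ i, l i * (d * linL a τ i) = d * ∑ i, l i * linL a τ i := by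
    rw [Finset.mul_sum]; exact Finset.sum_congr rfl fun i _ => by ring
  rw [e1, e2, h1, h2]; ring

/-- linear combination of the shifted coordinates -/
noncomputable def lc (v : Fin 3 → k) (b : Fin 3 → MvPolynomial (Fin 3) k) :
    MvPolynomial (Fin 3) k := ∑ i, b i * (X i - C (v i))

theorem eval_lc (v : Fin 3 → k) (b : Fin 3 → MvPolynomial (Fin 3) k) : eval v (lc v b) = 0 := by
  simp [lc]

theorem eval_pderiv_lc (v : Fin 3 → k) (b : Fin 3 → MvPolynomial (Fin 3) k) (j : Fin 3) :
    eval v (pderiv j (lc v b)) = eval v (b j) := by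
  simp [lc, Derivation.leibniz, pderiv_X, Pi.single_apply, Finset.sum_add_distrib]

theorem bind_lc (a : Fin 3 × Fin n → k) (v : Fin 3 → k) (b : Fin 3 → MvPolynomial (Fin 3) k) :
    bind₁ (ell a) (lc v b) = ∑ i, bind₁ (ell a) (b i) * yy a v i := by
  simp [lc, yy]

theorem eval_pderiv2_mul (v : Fin 3 → k) (f g : MvPolynomial (Fin 3) k) (hf : eval v f = 0)
    (s t : Fin 3) : eval v (pderiv s (pderiv t (f * g))) =
      eval v (pderiv s (pderiv t f)) * eval v g + eval v (pderiv t f) * eval v (pderiv s g)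
      + eval v (pderiv s f) * eval v (pderiv t g) := by
  simp only [Derivation.leibniz, smul_eq_mul, map_add, map_mul, hf]
  ring

theorem one_pt [IsAlgClosed k] {I : Ideal (MvPolynomial (Fin n) k)}
    (hI : ∃ S : Set (MvPolynomial (Fin n) k), I = Ideal.span S ∧ ∀ g ∈ S, ∃ d, g.IsHomogeneous d)
    (hsm : IsSmoothCurve I)
    (a : Fin 3 × Fin n → k) (hfin : (theta I a).Finite) (v : Fin 3 → k) (hv0 : v ≠ 0)
    (hinj : ∀ P ∈ projZeros I, P ≠ 0 → ∀ x ∈ tangentSpace I P, linL a x = 0 → x = 0)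
    (P : Fin n → k) (hP : P ∈ projZeros I) (hPv : linL a P = v)
    (huniq : ∀ Q ∈ projZeros I, linL a Q = v → Q = P) :
    ∃ g ∈ RingHom.ker (theta I a), ∃ j, eval v (pderiv j g) ≠ 0 := by
  have hP0 : P ≠ 0 := by rintro rfl; exact hv0 (by rw [← hPv, map_zero])
  obtain ⟨l, hl, hlT⟩ := exists_conormal hI hsm a hP hP0
  obtain ⟨c, hc, hcf⟩ := fibre_nakayama I a hfin v hv0 hinj (m := 1) (fun _ => P) (fun _ => 1)
    (fun Q hQ hQv => ⟨0, huniq Q hQ hQv⟩) (by intro i j; simp [Subsingleton.elim i j])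
  obtain ⟨A, hA, hAe⟩ := exists_syzygy I a v hv0 hinj (fun i => C (l i)) (by
    intro Q hQ hQv
    rw [huniq Q hQ hQv]
    intro x hx
    simpa using hlT x hx)
  choose r hr using fun i => hcf (A i)
  have hre : ∀ i, eval v (r i 0) = l i := by
    intro i
    have := hP _ (hr i)
    simp only [map_sub, map_mul, map_sum, eval_bind_ell, hPv, hc, hAe P hPv, eval_C] at this
    simp at this
    linear_combination -this
  refine ⟨lc v (fun i => r i 0), ?_, ?_⟩
  · rw [mem_ker_theta, bind_lc]
    have h1 : ∑ i, (bind₁ (ell a) c * A i - ∑ j, bind₁ (ell a) (r i j) * 1) * yy a v i ∈ I :=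
      I.sum_mem fun i _ => I.mul_mem_right _ (hr i)
    have h2 := I.mul_mem_left (bind₁ (ell a) c) hA
    have h3 := I.sub_mem h2 h1
    convert h3 using 1
    rw [Finset.mul_sum, ← Finset.sum_sub_distrib]
    refine Finset.sum_congr rfl fun i _ => ?_
    simp
    ring
  · obtain ⟨j, hj⟩ := Function.ne_iff.1 hl
    exact ⟨j, by rw [eval_pderiv_lc, hre]; exact hj⟩

theorem two_pt [IsAlgClosed k] {I : Ideal (MvPolynomial (Fin n) k)}
    (a : Fin 3 × Fin n → k) (hfin : (theta I a).Finite) (v : Fin 3 → k) (hv0 : v ≠ 0)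
    (hinj : ∀ P ∈ projZeros I, P ≠ 0 → ∀ x ∈ tangentSpace I P, linL a x = 0 → x = 0)
    (P Q : Fin n → k) (hP : P ∈ projZeros I) (hPv : linL a P = v)
    (hQ : Q ∈ projZeros I) (hQv : linL a Q = v) (hPQ : P ≠ Q)
    (huniq : ∀ R ∈ projZeros I, linL a R = v → R = P ∨ R = Q)
    (l m : Fin 3 → k)
    (hl : ∀ x ∈ tangentSpace I P, ∑ i, l i * linL a x i = 0)
    (hm : ∀ x ∈ tangentSpace I Q, ∑ i, m i * linL a x i = 0) :
    ∃ g ∈ RingHom.ker (theta I a), ∀ s t, eval v (pderiv s (pderiv t g)) =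
      l s * m t + l t * m s := by
  obtain ⟨j, hj⟩ := Function.ne_iff.1 hPQ
  set eP : MvPolynomial (Fin n) k := C ((P j - Q j)⁻¹) * (X j - C (Q j)) with heP
  have hPP : eval P eP = 1 := by
    simp [heP, inv_mul_cancel₀ (sub_ne_zero.2 hj)]
  have hQP : eval Q eP = 0 := by simp [heP]
  clear_value eP
  set eQ : MvPolynomial (Fin n) k := 1 - eP with heQ
  have hPQ' : eval P eQ = 0 := by simp [heQ, hPP]
  have hQQ : eval Q eQ = 1 := by simp [heQ, hQP]
  obtain ⟨c, hc, hcf⟩ := fibre_nakayama I a hfin v hv0 hinj (m := 2) ![P, Q] ![eP, eQ]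
    (fun R hR hRv => by
      rcases huniq R hR hRv with h | h
      · exact ⟨0, h⟩
      · exact ⟨1, h⟩)
    (by intro i j; fin_cases i <;> fin_cases j <;> simp [hPP, hQP, hPQ', hQQ])
  obtain ⟨A, hA, hAe⟩ := exists_syzygy I a v hv0 hinj (fun i => C (l i) * eP + C (m i) * eQ) (by
    intro R hR hRv
    rcases huniq R hR hRv with h | h
    · rw [h]
      intro x hx
      simpa [hPP, hPQ'] using hl x hx
    · rw [h]
      intro x hx
      simpa [hQP, hQQ] using hm x hx)
  choose r hr using fun i => hcf (A i * eP)
  choose s hs using fun i => hcf (A i * eQ)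
  simp only [Fin.sum_univ_two, Matrix.cons_val_zero, Matrix.cons_val_one] at hr hs
  have ev : ∀ (R : Fin n → k) (_ : R ∈ projZeros I) (_ : linL a R = v) (i : Fin 3),
      eval R (A i) * eval R eP = eval v (r i 0) * eval R eP + eval v (r i 1) * eval R eQ ∧
      eval R (A i) * eval R eQ = eval v (s i 0) * eval R eP + eval v (s i 1) * eval R eQ := by
    intro R hR hRv i
    have h1 := hR _ (hr i)
    have h2 := hR _ (hs i)
    simp only [map_sub, map_mul, map_add, eval_bind_ell, hRv, hc] at h1 h2
    exact ⟨by linear_combination h1, by linear_combination h2⟩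
  have hr0 : ∀ i, eval v (r i 0) = l i := fun i => by
    have := (ev P hP hPv i).1
    rw [hAe P hPv] at this
    simp only [map_add, map_mul, eval_C, hPP, hPQ'] at this
    linear_combination -this
  have hs0 : ∀ i, eval v (s i 0) = 0 := fun i => by
    have := (ev P hP hPv i).2
    rw [hAe P hPv] at this
    simp only [map_add, map_mul, eval_C, hPP, hPQ'] at this
    linear_combination -this
  have hr1 : ∀ i, eval v (r i 1) = 0 := fun i => by
    have := (ev Q hQ hQv i).1
    rw [hAe Q hQv] at this
    simp only [map_add, map_mul, eval_C, hQP, hQQ] at this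
    linear_combination -this
  have hs1 : ∀ i, eval v (s i 1) = m i := fun i => by
    have := (ev Q hQ hQv i).2
    rw [hAe Q hQv] at this
    simp only [map_add, map_mul, eval_C, hQP, hQQ] at this
    linear_combination -this
  refine ⟨lc v (fun i => r i 0) * lc v (fun i => s i 1)
    - lc v (fun i => r i 1) * lc v (fun i => s i 0), ?_, ?_⟩
  · rw [mem_ker_theta]
    have k1 : bind₁ (ell a) (lc v (fun i => r i 0)) * eP + bind₁ (ell a) (lc v (fun i => r i 1)) * eQ
        ∈ I := by
      rw [bind_lc, bind_lc]
      have h1 := I.sum_mem (t := Finset.univ) fun i _ => I.mul_mem_right (yy a v i) (hr i)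
      have h2 := I.mul_mem_left (bind₁ (ell a) c * eP) hA
      have h3 := I.sub_mem h2 h1
      convert h3 using 1
      rw [Finset.mul_sum, ← Finset.sum_sub_distrib, Finset.sum_mul, Finset.sum_mul,
        ← Finset.sum_add_distrib]
      exact Finset.sum_congr rfl fun i _ => by ring
    have k2 : bind₁ (ell a) (lc v (fun i => s i 0)) * eP + bind₁ (ell a) (lc v (fun i => s i 1)) * eQ
        ∈ I := by
      rw [bind_lc, bind_lc]
      have h1 := I.sum_mem (t := Finset.univ) fun i _ => I.mul_mem_right (yy a v i) (hs i)
      have h2 := I.mul_mem_left (bind₁ (ell a) c * eQ) hA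
      have h3 := I.sub_mem h2 h1
      convert h3 using 1
      rw [Finset.mul_sum, ← Finset.sum_sub_distrib, Finset.sum_mul, Finset.sum_mul,
        ← Finset.sum_add_distrib]
      exact Finset.sum_congr rfl fun i _ => by ring
    rw [map_sub, map_mul, map_mul]
    generalize bind₁ (ell a) (lc v (fun i => r i 0)) = u at *
    generalize bind₁ (ell a) (lc v (fun i => r i 1)) = w at *
    generalize bind₁ (ell a) (lc v (fun i => s i 0)) = x at *
    generalize bind₁ (ell a) (lc v (fun i => s i 1)) = z at *
    have := I.add_mem (I.mul_mem_left (z - x) k1) (I.mul_mem_left (u - w) k2)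
    convert this using 1
    rw [heQ]
    ring
  · intro i t
    rw [map_sub, map_sub, map_sub, eval_pderiv2_mul _ _ _ (eval_lc _ _),
      eval_pderiv2_mul _ _ _ (eval_lc _ _)]
    simp only [eval_lc, eval_pderiv_lc, hr0, hs0, hr1, hs1]
    ring

theorem no_pt [IsAlgClosed k] {I : Ideal (MvPolynomial (Fin n) k)}
    (a : Fin 3 × Fin n → k) (hfin : (theta I a).Finite) (v : Fin 3 → k) (hv0 : v ≠ 0)
    (hinj : ∀ P ∈ projZeros I, P ≠ 0 → ∀ x ∈ tangentSpace I P, linL a x = 0 → x = 0)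
    (hno : ∀ Q ∈ projZeros I, linL a Q ≠ v) :
    ∃ g ∈ RingHom.ker (theta I a), eval v g ≠ 0 := by
  obtain ⟨c, hc, hcf⟩ := fibre_nakayama I a hfin v hv0 hinj (m := 0) (fun _ => 0) (fun _ => 1)
    (fun Q hQ hQv => absurd hQv (hno Q hQ)) (fun i => i.elim0)
  refine ⟨c, ?_, by rw [hc]; exact one_ne_zero⟩
  obtain ⟨r, hr⟩ := hcf 1
  rw [mem_ker_theta]
  simpa using hr

theorem dirDeriv_two (F : MvPolynomial (Fin 3) k) (v w : Fin 3 → k) :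
    dirDeriv F v w 2 = ∑ s, ∑ t, eval v (pderiv s (pderiv t F)) * (w s * w t) := by
  unfold dirDeriv
  rw [← (finTwoArrowEquiv (Fin 3)).symm.sum_comp, Fintype.sum_prod_type]
  refine Finset.sum_congr rfl fun s _ => Finset.sum_congr rfl fun t _ => ?_
  simp [pderivList, Fin.prod_univ_two]

theorem node_of [CharZero k] (F h : MvPolynomial (Fin 3) k) (v l m w w' : Fin 3 → k)
    (hF : IsSingularAt F v)
    (hh : ∀ s t, eval v (pderiv s (pderiv t (F * h))) = l s * m t + l t * m s)
    (hlw : ∑ i, l i * w i = 0) (hmw : ∑ i, m i * w i ≠ 0)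
    (hmw' : ∑ i, m i * w' i = 0) (hlw' : ∑ i, l i * w' i ≠ 0) : IsNodeAt F v := by
  obtain ⟨hv0, hF0, hF1⟩ := hF
  have key : ∀ w, dirDeriv F v w 2 * eval v h = 2 * (∑ i, l i * w i) * (∑ i, m i * w i) := by
    intro w
    rw [dirDeriv_two]
    have : ∀ s t, eval v (pderiv s (pderiv t F)) * eval v h = l s * m t + l t * m s := by
      intro s t
      rw [← hh, eval_pderiv2_mul _ _ _ hF0, hF1, hF1]; ring
    have e : (∑ s, ∑ t, eval v (pderiv s (pderiv t F)) * (w s * w t)) * eval v h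
        = ∑ s, ∑ t, (l s * m t + l t * m s) * (w s * w t) := by
      rw [Finset.sum_mul]
      refine Finset.sum_congr rfl fun s _ => ?_
      rw [Finset.sum_mul]
      refine Finset.sum_congr rfl fun t _ => ?_
      rw [← this]; ring
    rw [e]
    simp only [Fin.sum_univ_three]
    ring
  have hns : ¬ ∃ (c : k) (l : Fin 3 → k), ∀ w : Fin 3 → k,
        dirDeriv F v w 2 = c * (∑ i, l i * w i) ^ 2 := by
    rintro ⟨c, q, hq⟩
    have h1 := key w
    have h2 := key w'
    have h3 := key (w + w')
    simp only [Pi.add_apply, mul_add, Finset.sum_add_distrib, hq, hlw, hmw', add_zero,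
      zero_add, mul_zero, zero_mul] at h1 h2 h3
    have hne : 2 * (∑ i, l i * w' i) * (∑ i, m i * w i) ≠ 0 :=
      mul_ne_zero (mul_ne_zero two_ne_zero hlw') hmw
    by_cases hch : c * eval v h = 0
    · apply hne
      rw [← h3]
      linear_combination (∑ i, q i * w i + ∑ i, q i * w' i) ^ 2 * hch
    · have e1 : ∑ i, q i * w i = 0 := by
        have : c * eval v h * (∑ i, q i * w i) ^ 2 = 0 := by linear_combination h1
        exact pow_eq_zero_iff two_ne_zero |>.1 ((mul_eq_zero.1 this).resolve_left hch)
      have e2 : ∑ i, q i * w' i = 0 := by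
        have : c * eval v h * (∑ i, q i * w' i) ^ 2 = 0 := by linear_combination h2
        exact pow_eq_zero_iff two_ne_zero |>.1 ((mul_eq_zero.1 this).resolve_left hch)
      apply hne
      rw [← h3, e1, e2]; ring
  refine ⟨hv0, hF0, ⟨?_, ?_⟩, hns⟩
  · intro s hs
    match s, hs with
    | [], _ => exact hF0
    | [i], _ => exact hF1 i
  · by_contra hcon
    push Not at hcon
    apply hns
    refine ⟨0, 0, fun w => ?_⟩
    rw [zero_mul, dirDeriv]
    refine Finset.sum_eq_zero fun s _ => ?_
    rw [hcon _ (List.length_ofFn), zero_mul]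

/-- Only nodes. -/
theorem sing_node [IsAlgClosed k] [CharZero k] {I : Ideal (MvPolynomial (Fin n) k)}
    (hI : ∃ S : Set (MvPolynomial (Fin n) k), I = Ideal.span S ∧ ∀ g ∈ S, ∃ d, g.IsHomogeneous d)
    (hsm : IsSmoothCurve I)
    (a : Fin 3 × Fin n → k) (hfin : (theta I a).Finite)
    (G2 : ∀ P ∈ projZeros I, P ≠ 0 → ∀ x ∈ tangentSpace I P, linL a x = 0 → x = 0)
    (G3 : ∀ P ∈ projZeros I, ∀ Q ∈ projZeros I, ∀ R ∈ projZeros I, P ≠ 0 → Q ≠ 0 → R ≠ 0 →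
      linL a P = linL a Q → linL a P = linL a R → P = Q ∨ P = R ∨ Q = R)
    (G4 : ∀ P ∈ projZeros I, ∀ Q ∈ projZeros I, P ≠ 0 → Q ≠ 0 → linL a P = linL a Q → P ≠ Q →
      ∀ l : Fin 3 → k, (∀ x ∈ tangentSpace I P, ∑ i, l i * linL a x i = 0) →
      (∀ x ∈ tangentSpace I Q, ∑ i, l i * linL a x i = 0) → l = 0)
    (F : MvPolynomial (Fin 3) k) (hF : RingHom.ker (theta I a) = Ideal.span {F})
    (v : Fin 3 → k) (hv : IsSingularAt F v) : IsNodeAt F v := by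
  have hv0 := hv.1
  have hz : ∀ P : Fin n → k, linL a P = v → P ≠ 0 := by
    rintro P hP rfl; exact hv0 (by rw [← hP, map_zero])
  have hmem : ∀ g ∈ RingHom.ker (theta I a), ∃ h, g = F * h := by
    intro g hg
    rw [hF, Ideal.mem_span_singleton] at hg
    exact hg
  by_cases hno : ∀ Q ∈ projZeros I, linL a Q ≠ v
  · obtain ⟨g, hg, hgv⟩ := no_pt a hfin v hv0 G2 hno
    obtain ⟨h, rfl⟩ := hmem g hg
    exact absurd (by rw [map_mul, hv.2.1, zero_mul]) hgv
  push Not at hno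
  obtain ⟨P, hP, hPv⟩ := hno
  by_cases huniq : ∀ Q ∈ projZeros I, linL a Q = v → Q = P
  · obtain ⟨g, hg, j, hgv⟩ := one_pt hI hsm a hfin v hv0 G2 P hP hPv huniq
    obtain ⟨h, rfl⟩ := hmem g hg
    refine absurd ?_ hgv
    simp [Derivation.leibniz, hv.2.1, hv.2.2]
  push Not at huniq
  obtain ⟨Q, hQ, hQv, hQP⟩ := huniq
  have hP0 := hz P hPv
  have hQ0 := hz Q hQv
  obtain ⟨l, hl0, hl⟩ := exists_conormal hI hsm a hP hP0
  obtain ⟨m, hm0, hm⟩ := exists_conormal hI hsm a hQ hQ0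
  obtain ⟨g, hg, hgd⟩ := two_pt a hfin v hv0 G2 P Q hP hPv hQ hQv (Ne.symm hQP) (by
    intro R hR hRv
    rcases G3 P hP Q hQ R hR hP0 hQ0 (hz R hRv) (hPv.trans hQv.symm) (hPv.trans hRv.symm)
      with h | h | h
    · exact absurd h.symm hQP
    · exact Or.inl h.symm
    · exact Or.inr h.symm) l m hl hm
  obtain ⟨h, rfl⟩ := hmem g hg
  have h1 : ∃ x ∈ tangentSpace I P, ∑ i, m i * linL a x i ≠ 0 := by
    by_contra hcon
    push Not at hcon
    exact hm0 (G4 P hP Q hQ hP0 hQ0 (hPv.trans hQv.symm) (Ne.symm hQP) m hcon hm)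
  have h2 : ∃ x ∈ tangentSpace I Q, ∑ i, l i * linL a x i ≠ 0 := by
    by_contra hcon
    push Not at hcon
    exact hl0 (G4 P hP Q hQ hP0 hQ0 (hPv.trans hQv.symm) (Ne.symm hQP) l hl hcon)
  obtain ⟨x, hx, hx'⟩ := h1
  obtain ⟨y, hy, hy'⟩ := h2
  exact node_of F h v l m (linL a x) (linL a y) hv hgd (hl x hx) hx' (hm y hy) hy'

end Fib7

open MvPolynomial

section Ker8

theorem ker_principal_abs {R S : Type} [CommRing R] [IsDomain R] [UniqueFactorizationMonoid R]
    [CommRing S] [IsDomain S] (θ : R →+* S) (hθ : θ.Finite)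
    (hR : ringKrullDim R = 3) (hS : ringKrullDim S = 2) (hk : RingHom.ker θ ≠ ⊥) :
    ∃ F, Prime F ∧ RingHom.ker θ = Ideal.span {F} := by
  have hq : (RingHom.ker θ).IsPrime := RingHom.ker_isPrime θ
  obtain ⟨F, hFm, hF⟩ := hq.exists_mem_prime_of_ne_bot hk
  refine ⟨F, hF, ?_⟩
  by_contra hne
  have hle : Ideal.span {F} ≤ RingHom.ker θ := by
    rw [Ideal.span_singleton_le_iff_mem]; exact hFm
  have hlt : Ideal.span {F} < RingHom.ker θ := lt_of_le_of_ne hle (Ne.symm hne)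
  letI := θ.toAlgebra
  haveI : Module.Finite R S := hθ
  have h_integral : ∀ x : S, IsIntegral R x := fun x => Algebra.IsIntegral.isIntegral x
  obtain ⟨s, hs⟩ := (Order.le_krullDim_iff (α := PrimeSpectrum S) (n := 2)).1 (by
    show _ ≤ ringKrullDim S
    rw [hS]; rfl)
  have strict : ∀ p q : PrimeSpectrum S, p < q →
      p.asIdeal.comap θ < q.asIdeal.comap θ := by
    intro p q hpq
    have h1 : p.asIdeal < q.asIdeal := hpq
    obtain ⟨x, hx, hx'⟩ := Set.exists_of_ssubset (show (p.asIdeal : Set S) ⊂ q.asIdeal from h1)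
    haveI := p.2
    exact Ideal.comap_lt_comap_of_integral_mem_sdiff h1.le ⟨hx, hx'⟩ (h_integral x)
  have hp : ∀ p : PrimeSpectrum S, (p.asIdeal.comap θ).IsPrime := fun p =>
    haveI := p.2; Ideal.comap_isPrime θ _
  have hs01 : s ⟨0, by omega⟩ < s ⟨1, by omega⟩ :=
    s.strictMono (Fin.mk_lt_mk.2 (by omega))
  have hs12 : s ⟨1, by omega⟩ < s ⟨2, by omega⟩ :=
    s.strictMono (Fin.mk_lt_mk.2 (by omega))
  generalize s ⟨0, by omega⟩ = p0 at *
  generalize s ⟨1, by omega⟩ = p1 at *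
  generalize s ⟨2, by omega⟩ = p2 at *
  haveI := hp p0
  haveI := hp p1
  haveI := hp p2
  have hFp : (Ideal.span {F}).IsPrime := (Ideal.span_singleton_prime hF.ne_zero).2 hF
  have h0 : Ideal.span {F} < p0.asIdeal.comap θ :=
    lt_of_lt_of_le hlt (Ideal.comap_mono bot_le)
  have hbot : (⊥ : Ideal R) < Ideal.span {F} := bot_lt_iff_ne_bot.2 (by
    rw [Ne, Ideal.span_singleton_eq_bot]; exact hF.ne_zero)
  have e0 := Ideal.height_add_one_le_of_lt_of_isPrime hbot
  have e1 := Ideal.height_add_one_le_of_lt_of_isPrime h0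
  have e2 := Ideal.height_add_one_le_of_lt_of_isPrime (strict _ _ hs01)
  have e3 := Ideal.height_add_one_le_of_lt_of_isPrime (strict _ _ hs12)
  have e4 : ((p2.asIdeal.comap θ).height : WithBot ℕ∞) ≤ ringKrullDim R :=
    Ideal.height_le_ringKrullDim_of_isPrime
  rw [hR] at e4
  have e5 : (p2.asIdeal.comap θ).height ≤ 3 :=
    WithBot.coe_le_coe.1 e4
  have e6 : (4 : ℕ∞) ≤ (p2.asIdeal.comap θ).height := by
    calc (4 : ℕ∞) = 0 + 1 + 1 + 1 + 1 := by norm_num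
      _ ≤ (⊥ : Ideal R).height + 1 + 1 + 1 + 1 := by gcongr; exact bot_le
      _ ≤ _ := by
        refine le_trans ?_ e3
        gcongr
        refine le_trans ?_ e2
        gcongr
        refine le_trans ?_ e1
        gcongr
  exact absurd (e6.trans e5) (by decide)

variable {k : Type} [Field k] {n : ℕ}

theorem ker_principal {I : Ideal (MvPolynomial (Fin n) k)} (hI : IsProjCurveIdeal I)
    (a : Fin 3 × Fin n → k) (hfin : (theta I a).Finite) (hk : RingHom.ker (theta I a) ≠ ⊥) :
    ∃ F, Irreducible F ∧ (∃ d, F.IsHomogeneous d) ∧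
      RingHom.ker (theta I a) = Ideal.span {F} := by
  haveI := hI.prime
  obtain ⟨F, hF, hker⟩ := ker_principal_abs (theta I a) hfin (by
    rw [MvPolynomial.ringKrullDim_of_isNoetherianRing]; simp) hI.dim hk
  refine ⟨F, hF.irreducible, ⟨F.totalDegree, ?_⟩, hker⟩
  have hm : F ∈ RingHom.ker (theta I a) := by rw [hker]; exact Ideal.mem_span_singleton_self F
  have hm' : homogeneousComponent F.totalDegree F ∈ RingHom.ker (theta I a) := by
    rw [mem_ker_theta] at hm ⊢
    rw [← homComp_bind]
    exact homComp_mem hI.homog hm _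
  rw [hker, Ideal.mem_span_singleton] at hm'
  obtain ⟨h, hh⟩ := hm'
  have hhom := homogeneousComponent_isHomogeneous F.totalDegree F
  have hne : homogeneousComponent F.totalDegree F ≠ 0 := by
    intro h0
    obtain ⟨d, hd, hdeg⟩ : ∃ d ∈ F.support, d.degree = F.totalDegree := by
      have := Finset.exists_mem_eq_sup F.support (support_nonempty.2 hF.ne_zero)
        (fun s => s.sum fun _ e => e)
      obtain ⟨d, hd, h⟩ := this
      exact ⟨d, hd, h.symm⟩
    have := congrArg (coeff d) h0
    rw [coeff_homogeneousComponent, if_pos hdeg, coeff_zero] at this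
    exact mem_support_iff.1 hd this
  have hh0 : h ≠ 0 := by rintro rfl; exact hne (by rw [hh, mul_zero])
  have ht := congrArg totalDegree hh
  rw [hhom.totalDegree hne, totalDegree_mul_of_isDomain hF.ne_zero hh0] at ht
  have h0 : h.totalDegree = 0 := by omega
  rw [totalDegree_eq_zero_iff_eq_C] at h0
  set c := coeff 0 h
  have hc : c ≠ 0 := by intro hc; rw [hc, C_0] at h0; exact hh0 h0
  have : F = C c⁻¹ * homogeneousComponent F.totalDegree F := by
    rw [hh, h0, mul_comm F, ← mul_assoc, ← C_mul, inv_mul_cancel₀ hc, C_1, one_mul]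
  have h2 := (isHomogeneous_C (Fin 3) c⁻¹).mul hhom
  rw [zero_add, ← this] at h2
  exact h2

theorem exists_ne_zero_pt [IsAlgClosed k] {I : Ideal (MvPolynomial (Fin n) k)}
    (hI : IsProjCurveIdeal I) : ∃ P ∈ projZeros I, P ≠ 0 := by
  by_contra hcon
  push Not at hcon
  haveI := hI.prime
  have hX : ∀ j, (X j : MvPolynomial (Fin n) k) ∈ I := by
    intro j
    have : (X j : MvPolynomial (Fin n) k) ∈ I.radical := by
      rw [← vanishingIdeal_zeroLocus_eq_radical (K := k), mem_vanishingIdeal_iff]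
      intro P hP
      rw [mem_zeroLocus_iff] at hP
      rw [hcon P (fun f hf => by simpa [aeval_eq_eval] using hP f hf)]
      simp
    rwa [hI.prime.radical] at this
  have hmod : ∀ f : MvPolynomial (Fin n) k, ∃ c : k, f - C c ∈ I := by
    intro f
    induction f using MvPolynomial.induction_on with
    | C c => exact ⟨c, by simp⟩
    | add p q hp hq =>
      obtain ⟨c, hc⟩ := hp
      obtain ⟨d, hd⟩ := hq
      refine ⟨c + d, ?_⟩
      convert I.add_mem hc hd using 1
      rw [C_add]; ring
    | mul_X p j _ => exact ⟨0, by simpa using I.mul_mem_left p (hX j)⟩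
  have hfield : IsField (MvPolynomial (Fin n) k ⧸ I) := by
    refine ⟨exists_pair_ne _, mul_comm, ?_⟩
    intro x hx
    obtain ⟨f, rfl⟩ := Ideal.Quotient.mk_surjective x
    obtain ⟨c, hc⟩ := hmod f
    have e : Ideal.Quotient.mk I f = Ideal.Quotient.mk I (C c) := Ideal.Quotient.eq.2 hc
    have hc0 : c ≠ 0 := by rintro rfl; exact hx (by rw [e, C_0, map_zero])
    exact ⟨Ideal.Quotient.mk I (C c⁻¹), by
      rw [e, ← map_mul, ← C_mul, mul_inv_cancel₀ hc0, C_1, map_one]⟩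
  have h1 := ringKrullDim_eq_zero_of_isField hfield
  rw [hI.dim] at h1
  exact absurd h1 (by decide)

end Ker8

open MvPolynomial

section Bir9

variable {k : Type} [Field k] {n : ℕ}

theorem bind_scale (f lam : MvPolynomial (Fin n) k) (e : ℕ) (hf : f.IsHomogeneous e) :
    bind₁ (fun j => lam * X j) f = lam ^ e * f := by
  conv_lhs => rw [f.as_sum]
  conv_rhs => rw [f.as_sum]
  rw [map_sum, Finset.mul_sum]
  refine Finset.sum_congr rfl fun s hs => ?_
  have hd := hf (mem_support_iff.1 hs)
  have hd' : s.sum (fun _ m => m) = e := by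
    rw [← hd, Finsupp.weight_apply]
    simp
  rw [bind₁_monomial, monomial_eq, Finsupp.prod]
  simp only [mul_pow, Finset.prod_mul_distrib, Finset.prod_pow_eq_pow_sum]
  rw [← hd', Finsupp.sum]
  ring

theorem bind_ell_congr (I : Ideal (MvPolynomial (Fin n) k)) {σ : Type}
    (g g' : σ → MvPolynomial (Fin n) k) (h : ∀ j, g j - g' j ∈ I) (f : MvPolynomial σ k) :
    bind₁ g f - bind₁ g' f ∈ I := by
  have : (Ideal.Quotient.mkₐ k I).comp (bind₁ g) = (Ideal.Quotient.mkₐ k I).comp (bind₁ g') := by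
    apply algHom_ext
    intro j
    simpa using Ideal.Quotient.eq.2 (h j)
  exact Ideal.Quotient.eq.1 (DFunLike.congr_fun this f)

theorem bir [IsAlgClosed k] {I : Ideal (MvPolynomial (Fin n) k)}
    (hI : ∃ S : Set (MvPolynomial (Fin n) k), I = Ideal.span S ∧ ∀ g ∈ S, ∃ d, g.IsHomogeneous d)
    (a : Fin 3 × Fin n → k) (hfin : (theta I a).Finite) (v : Fin 3 → k) (hv0 : v ≠ 0)
    (hinj : ∀ P ∈ projZeros I, P ≠ 0 → ∀ x ∈ tangentSpace I P, linL a x = 0 → x = 0)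
    (P : Fin n → k) (hP : P ∈ projZeros I) (hPv : linL a P = v)
    (huniq : ∀ Q ∈ projZeros I, linL a Q = v → Q = P) :
    IdealBirEquiv I (RingHom.ker (theta I a)) := by
  obtain ⟨c, hc, hcf⟩ := fibre_nakayama I a hfin v hv0 hinj (m := 1) (fun _ => P) (fun _ => 1)
    (fun Q hQ hQv => ⟨0, huniq Q hQ hQv⟩) (by intro i j; simp [Subsingleton.elim i j])
  choose b hb using fun j => hcf (X j)
  have hcI : ∃ d, bind₁ (ell a) (homogeneousComponent d c) ∉ I := by
    by_contra hcon
    push Not at hcon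
    have : bind₁ (ell a) c ∈ I := by
      rw [← sum_homogeneousComponent c, map_sum]
      exact I.sum_mem fun i _ => hcon i
    have := hP _ this
    rw [eval_bind_ell, hPv, hc] at this
    exact one_ne_zero this
  obtain ⟨d, hd⟩ := hcI
  set mu := homogeneousComponent d c with hmu
  set lam := bind₁ (ell a) mu with hlam
  set ψ : Fin n → MvPolynomial (Fin 3) k := fun j => homogeneousComponent (d + 1) (b j 0) with hψ
  have key : ∀ j, bind₁ (ell a) (ψ j) - lam * X j ∈ I := by
    intro j
    have h1 := homComp_mem hI (hb j) (d + 1)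
    rw [map_sub, homComp_mul _ _ _ _ (isHomogeneous_X k j), homComp_bind] at h1
    simp only [Finset.univ_unique, Fin.default_eq_zero, Finset.sum_singleton, mul_one,
      homComp_bind] at h1
    have h2 := I.neg_mem h1
    rw [neg_sub] at h2
    exact h2
  refine ⟨ell a, ψ, ⟨1, ell_homog a⟩, ⟨d + 1, fun i => homogeneousComponent_isHomogeneous _ _⟩,
    fun g hg => (mem_ker_theta I a g).1 hg, ?_, ⟨lam, hd, key⟩, ⟨mu, ?_, ?_⟩⟩
  · intro f hf
    rw [mem_ker_theta]
    obtain ⟨S, rfl, hS⟩ := hI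
    have hle : Ideal.span S ≤ (Ideal.span S).comap
        ((bind₁ (ell a)).comp (bind₁ ψ) : MvPolynomial (Fin n) k →ₐ[k] _) := by
      refine Ideal.span_le.2 ?_
      intro g hg
      obtain ⟨e, he⟩ := hS g hg
      rw [SetLike.mem_coe, Ideal.mem_comap, AlgHom.comp_apply, bind₁_bind₁]
      have h1 := bind_ell_congr (Ideal.span S) _ (fun j => lam * X j) key g
      rw [bind_scale _ _ e he] at h1
      have h2 := Ideal.mul_mem_left _ (lam ^ e) (Ideal.subset_span hg)
      have h3 := Ideal.add_mem _ h1 h2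
      rwa [sub_add_cancel] at h3
    exact hle hf
  · rw [mem_ker_theta]; exact hd
  · intro i
    rw [mem_ker_theta, map_sub, map_mul, bind₁_X_right, ell, map_sum, map_sum]
    have h1 : ∑ j, C (a (i, j)) * (bind₁ (ell a) (ψ j) - lam * X j) ∈ I :=
      I.sum_mem fun j _ => I.mul_mem_left _ (key j)
    convert h1 using 1
    rw [Finset.mul_sum, ← Finset.sum_sub_distrib]
    refine Finset.sum_congr rfl fun j _ => ?_
    simp only [map_mul, bind₁_C_right, bind₁_X_right, ← hlam]
    ring

end Bir9

/-- Every smooth projective curve over an algebraically closed field of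
characteristic zero is birationally equivalent to a plane curve with only nodes as
singularities. -/
theorem smooth_curve_birational_to_nodal_plane_curve
    {k : Type} [Field k] [IsAlgClosed k] [CharZero k]
    (N : ℕ) (I : Ideal (MvPolynomial (Fin (N + 1)) k))
    (hI : IsProjCurveIdeal I) (hsm : IsSmoothCurve I) :
    ∃ D : PlaneCurve k,
      IdealBirEquiv I (Ideal.span {D.F}) ∧
      ∀ v : Fin 3 → k, IsSingularAt D.F v → IsNodeAt D.F v := by
  obtain ⟨P0, hP0, hP00⟩ := exists_ne_zero_pt hI
  obtain ⟨a, G1, G2, G3, G4, G5⟩ := exists_good_projection hI.homog hsm P0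
  have hfin := theta_finite hI.homog a G1
  have hv0 := G1 P0 hP0 hP00
  have huniq : ∀ Q ∈ projZeros I, linL a Q = linL a P0 → Q = P0 := by
    intro Q hQ hQv
    refine (G5 Q hQ ?_ hQv.symm).symm
    rintro rfl
    exact hv0 (by rw [← hQv, map_zero])
  have hk : RingHom.ker (theta I a) ≠ ⊥ := by
    intro h0
    obtain ⟨g, hg, j, hgj⟩ := one_pt hI.homog hsm a hfin _ hv0 G2 P0 hP0 rfl huniq
    rw [h0, Ideal.mem_bot] at hg
    exact hgj (by rw [hg]; simp)
  obtain ⟨F, hirr, ⟨d, hd⟩, hker⟩ := ker_principal hI a hfin hk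
  refine ⟨⟨d, F, hd, hirr⟩, ?_, ?_⟩
  · have := bir hI.homog a hfin _ hv0 G2 P0 hP0 rfl huniq
    rwa [hker] at this
  · intro v hv
    exact sing_node hI.homog hsm a hfin G2 G3 G4 F hker v hv
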